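/- arXiv:2411.12272 — 7 statements merged into one kernel-verified Lean document; each statement's English description precedes it below -/
import Mathlib

section
/- Let ν be a σ-finite Borel measure on (0,∞) with first moment M₁ = ∫₀^∞ z ν(dz) satisfying 0 < M₁ < 1, let ρ be a Borel probability measure on (0,∞), let w ∈ [0,1], θ ≥ 0 and T > 0. Then there exists a unique bounded continuous function φ : [0,T] × (0,∞) → ℝ that is nonnegative and satisfies, for all t ∈ [0,T] and all r > 0, φ(t,r) = θ·e^{−r t} + ∫₀ᵗ e^{−r(t−s)} r [ w ∫₀^∞ (1 − e^{−φ(s,r) z}) ν(dz) + (1−w) ∫₀^∞ ∫₀^∞ (1 − e^{−φ(s,u) z}) ν(dz) ρ(du) ] ds; moreover this solution satisfies sup_{(t,r) ∈ [0,T]×(0,∞)} φ(t,r) ≤ θ (1 − M₁)^{−1}. -/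
open MeasureTheory

/-- The Riccati operator `𝔾` of the aggregation model:
`𝔾(φ)(t,r) = θ e^{-rt} + ∫₀ᵗ e^{-r(t-s)} r [ w ∫ (1-e^{-φ(s,r)z}) ν(dz)
  + (1-w) ∫∫ (1-e^{-φ(s,u)z}) ν(dz) ρ(du) ] ds`. -/
noncomputable def riccatiOp (ν ρ : Measure ℝ) (w θ : ℝ)
    (φ : ℝ → ℝ → ℝ) (t r : ℝ) : ℝ :=
  θ * Real.exp (-(r * t)) +
    ∫ s in (0:ℝ)..t, Real.exp (-(r * (t - s))) * r *
      (w * (∫ z in Set.Ioi (0:ℝ), (1 - Real.exp (-(φ s r * z))) ∂ν) +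
       (1 - w) * ∫ u in Set.Ioi (0:ℝ),
          (∫ z in Set.Ioi (0:ℝ), (1 - Real.exp (-(φ s u * z))) ∂ν) ∂ρ)

/-- The Laplace-type exponent `x ↦ ∫ (1 - e^{-xz}) ν(dz)`, extended by `0` to negative `x`. -/
noncomputable def jumpExponent (ν : Measure ℝ) (x : ℝ) : ℝ :=
  ∫ z in Set.Ioi (0:ℝ), (1 - Real.exp (-(max x 0 * z))) ∂ν

/-- The bracket in the Riccati operator, with `r = e^a` as the space variable. -/
noncomputable def riccatiSource (ν ρ : Measure ℝ) (w : ℝ) (Φ : ℝ × ℝ → ℝ) (s a : ℝ) : ℝ :=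
  w * jumpExponent ν (Φ (s, a)) +
    (1 - w) * ∫ u in Set.Ioi (0:ℝ), jumpExponent ν (Φ (s, Real.log u)) ∂ρ

/-- The Riccati operator in the variables `(t, log r)`, with `t` clamped to `[0, T]`. -/
noncomputable def riccatiLogOp (ν ρ : Measure ℝ) (w θ T : ℝ) (Φ : ℝ × ℝ → ℝ) (p : ℝ × ℝ) : ℝ :=
  θ * Real.exp (-(Real.exp p.2 * max 0 (min p.1 T))) +
    ∫ s in (0:ℝ)..max 0 (min p.1 T),
      Real.exp (-(Real.exp p.2 * (max 0 (min p.1 T) - s))) * Real.exp p.2 *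
        riccatiSource ν ρ w Φ s p.2

lemma abs_exp_neg_sub_exp_neg_le {x y : ℝ} (hx : 0 ≤ x) (hy : 0 ≤ y) :
    |Real.exp (-x) - Real.exp (-y)| ≤ |x - y| := by
  wlog h : x ≤ y generalizing x y
  · rw [abs_sub_comm, abs_sub_comm x]
    exact this hy hx (le_of_not_ge h)
  have h1 : Real.exp (-y) ≤ Real.exp (-x) := Real.exp_le_exp.2 (by linarith)
  rw [abs_of_nonneg (by linarith), abs_of_nonpos (by linarith)]
  have h2 : Real.exp (-y) = Real.exp (-x) * Real.exp (x - y) := by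
    rw [← Real.exp_add]; ring_nf
  have h3 := Real.add_one_le_exp (x - y)
  have h4 : Real.exp (-x) ≤ 1 := Real.exp_le_one_iff.2 (by linarith)
  have h5 := Real.exp_pos (-x)
  nlinarith

lemma integrableOn_one_sub_exp_neg {ν : Measure ℝ}
    (hν : IntegrableOn (fun z : ℝ => z) (Set.Ioi 0) ν) {x : ℝ} (hx : 0 ≤ x) :
    IntegrableOn (fun z : ℝ => 1 - Real.exp (-(x * z))) (Set.Ioi 0) ν := by
  refine Integrable.mono' (hν.const_mul x) (by fun_prop) ?_
  filter_upwards [ae_restrict_mem measurableSet_Ioi] with z hz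
  have := abs_exp_neg_sub_exp_neg_le (le_refl 0) (mul_nonneg hx (le_of_lt hz))
  simpa [abs_of_nonneg hx, abs_of_pos (Set.mem_Ioi.1 hz)] using this

lemma jumpExponent_nonneg (ν : Measure ℝ) (x : ℝ) : 0 ≤ jumpExponent ν x := by
  refine setIntegral_nonneg measurableSet_Ioi fun z hz => ?_
  have : Real.exp (-(max x 0 * z)) ≤ 1 :=
    Real.exp_le_one_iff.2 (by have := mul_nonneg (le_max_right x 0) (le_of_lt hz); linarith)
  linarith

lemma abs_jumpExponent_sub_le {ν : Measure ℝ}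
    (hν : IntegrableOn (fun z : ℝ => z) (Set.Ioi 0) ν) (x y : ℝ) :
    |jumpExponent ν x - jumpExponent ν y| ≤ (∫ z in Set.Ioi (0:ℝ), z ∂ν) * |x - y| := by
  unfold jumpExponent
  rw [← integral_sub (integrableOn_one_sub_exp_neg hν (le_max_right x 0))
    (integrableOn_one_sub_exp_neg hν (le_max_right y 0)), mul_comm, ← integral_const_mul]
  rw [← Real.norm_eq_abs]
  refine norm_integral_le_of_norm_le (hν.const_mul _) ?_
  filter_upwards [ae_restrict_mem measurableSet_Ioi] with z hz
  have hz : 0 < z := hz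
  have h1 := abs_exp_neg_sub_exp_neg_le (mul_nonneg (le_max_right y 0) hz.le)
    (mul_nonneg (le_max_right x 0) hz.le)
  have h2 : |max x 0 - max y 0| ≤ |x - y| := abs_max_sub_max_le_abs x y 0
  rw [← sub_mul, abs_mul, abs_of_pos hz, abs_sub_comm (max y 0)] at h1
  rw [Real.norm_eq_abs, sub_sub_sub_cancel_left]
  exact h1.trans (mul_le_mul_of_nonneg_right h2 hz.le)

lemma jumpExponent_zero (ν : Measure ℝ) : jumpExponent ν 0 = 0 := by
  simp [jumpExponent]

lemma abs_jumpExponent_le {ν : Measure ℝ}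
    (hν : IntegrableOn (fun z : ℝ => z) (Set.Ioi 0) ν) (x : ℝ) :
    |jumpExponent ν x| ≤ (∫ z in Set.Ioi (0:ℝ), z ∂ν) * |x| := by
  simpa [jumpExponent_zero] using abs_jumpExponent_sub_le hν x 0

lemma setIntegral_Ioi_id_nonneg (ν : Measure ℝ) : 0 ≤ ∫ z in Set.Ioi (0:ℝ), z ∂ν :=
  setIntegral_nonneg measurableSet_Ioi fun _ hz => le_of_lt hz

lemma continuous_jumpExponent {ν : Measure ℝ}
    (hν : IntegrableOn (fun z : ℝ => z) (Set.Ioi 0) ν) : Continuous (jumpExponent ν) :=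
  (LipschitzWith.of_dist_le_mul (K := ⟨_, setIntegral_Ioi_id_nonneg ν⟩)
    (abs_jumpExponent_sub_le hν)).continuous

/-- The exponential kernel `r e^{-r(t-s)}` has mass at most one on `[0, t]`. -/
lemma abs_integral_exp_kernel_mul_le {r t c : ℝ} (hr : 0 ≤ r) (ht : 0 ≤ t) (hc : 0 ≤ c)
    {B : ℝ → ℝ} (hB : ∀ s, |B s| ≤ c) :
    |∫ s in (0:ℝ)..t, Real.exp (-(r * (t - s))) * r * B s| ≤ c := by
  have hcont : Continuous fun s : ℝ => Real.exp (-(r * (t - s))) * r := by fun_prop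
  have hmass : ∫ s in (0:ℝ)..t, Real.exp (-(r * (t - s))) * r = 1 - Real.exp (-(r * t)) := by
    rw [intervalIntegral.integral_eq_sub_of_hasDerivAt
      (f := fun s => Real.exp (-(r * (t - s)))) (fun s _ => ?_) (hcont.intervalIntegrable _ _)]
    · simp
    · have : HasDerivAt (fun s => -(r * (t - s))) r s := by
        simpa [Pi.neg_def] using (((hasDerivAt_id s).const_sub t).const_mul r).neg
      exact this.exp
  calc |∫ s in (0:ℝ)..t, Real.exp (-(r * (t - s))) * r * B s|
      ≤ ∫ s in (0:ℝ)..t, Real.exp (-(r * (t - s))) * r * c := by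
        have hint := (hcont.intervalIntegrable (μ := volume) 0 t).mul_const c
        rw [← Real.norm_eq_abs]
        refine intervalIntegral.norm_integral_le_of_norm_le ht ?_ hint
        filter_upwards with s _
        rw [Real.norm_eq_abs, abs_mul, abs_of_nonneg (by positivity)]
        exact mul_le_mul_of_nonneg_left (hB s) (by positivity)
    _ = (1 - Real.exp (-(r * t))) * c := by rw [intervalIntegral.integral_mul_const, hmass]
    _ ≤ c := by nlinarith [Real.exp_pos (-(r * t))]

lemma riccatiSource_nonneg {ν ρ : Measure ℝ} {w : ℝ} (hw : w ∈ Set.Icc (0:ℝ) 1)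
    (Φ : ℝ × ℝ → ℝ) (s a : ℝ) :
    0 ≤ riccatiSource ν ρ w Φ s a :=
  add_nonneg (mul_nonneg hw.1 (jumpExponent_nonneg _ _))
    (mul_nonneg (sub_nonneg.2 hw.2) (integral_nonneg fun _ => jumpExponent_nonneg _ _))

lemma riccatiLogOp_nonneg {ν ρ : Measure ℝ} {w : ℝ} (hw : w ∈ Set.Icc (0:ℝ) 1) {θ : ℝ}
    (hθ : 0 ≤ θ) (T : ℝ) (Φ : ℝ × ℝ → ℝ) (p : ℝ × ℝ) : 0 ≤ riccatiLogOp ν ρ w θ T Φ p :=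
  add_nonneg (mul_nonneg hθ (Real.exp_pos _).le)
    (intervalIntegral.integral_nonneg (le_max_left _ _) fun s _ =>
      mul_nonneg (by positivity) (riccatiSource_nonneg hw Φ s p.2))

section

open BoundedContinuousFunction

variable {ν ρ : Measure ℝ} [IsProbabilityMeasure ρ] {w : ℝ}

lemma integrableOn_jumpExponent_comp (hν : IntegrableOn (fun z : ℝ => z) (Set.Ioi 0) ν)
    (Φ : (ℝ × ℝ) →ᵇ ℝ) (s : ℝ) :
    IntegrableOn (fun u => jumpExponent ν (Φ (s, Real.log u))) (Set.Ioi 0) ρ := by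
  have hm : Measurable fun u => jumpExponent ν (Φ (s, Real.log u)) :=
    ((continuous_jumpExponent hν).comp Φ.continuous).measurable.comp
      (measurable_const.prodMk Real.measurable_log)
  refine Integrable.mono' (integrable_const ((∫ z in Set.Ioi (0:ℝ), z ∂ν) * ‖Φ‖))
    hm.aestronglyMeasurable (.of_forall fun u => ?_)
  exact (abs_jumpExponent_le hν _).trans
    (mul_le_mul_of_nonneg_left (Φ.norm_coe_le_norm _) (setIntegral_Ioi_id_nonneg ν))

lemma continuous_riccatiSource (hν : IntegrableOn (fun z : ℝ => z) (Set.Ioi 0) ν)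
    (Φ : (ℝ × ℝ) →ᵇ ℝ) : Continuous fun q : ℝ × ℝ => riccatiSource ν ρ w Φ q.1 q.2 := by
  have hg := continuous_jumpExponent hν
  have h : Continuous fun s => ∫ u in Set.Ioi (0:ℝ), jumpExponent ν (Φ (s, Real.log u)) ∂ρ := by
    refine continuous_of_dominated
      (bound := fun _ => (∫ z in Set.Ioi (0:ℝ), z ∂ν) * ‖Φ‖)
      (fun s => (integrableOn_jumpExponent_comp hν Φ s).aestronglyMeasurable)
      (fun s => .of_forall fun u => ?_) (integrable_const _) (.of_forall fun u => ?_)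
    · exact (abs_jumpExponent_le hν _).trans
        (mul_le_mul_of_nonneg_left (Φ.norm_coe_le_norm _) (setIntegral_Ioi_id_nonneg ν))
    · exact hg.comp (Φ.continuous.comp (by fun_prop))
  exact ((hg.comp Φ.continuous).const_mul w).add ((h.comp continuous_fst).const_mul (1 - w))

lemma abs_riccatiSource_sub_le (hν : IntegrableOn (fun z : ℝ => z) (Set.Ioi 0) ν)
    (hw : w ∈ Set.Icc (0:ℝ) 1) (Φ Ψ : (ℝ × ℝ) →ᵇ ℝ) (s a : ℝ) :
    |riccatiSource ν ρ w Φ s a - riccatiSource ν ρ w Ψ s a| ≤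
      (∫ z in Set.Ioi (0:ℝ), z ∂ν) * dist Φ Ψ := by
  set c := (∫ z in Set.Ioi (0:ℝ), z ∂ν) * dist Φ Ψ
  have hc : 0 ≤ c := mul_nonneg (setIntegral_Ioi_id_nonneg ν) dist_nonneg
  have hpt : ∀ q, |jumpExponent ν (Φ q) - jumpExponent ν (Ψ q)| ≤ c := fun q =>
    (abs_jumpExponent_sub_le hν _ _).trans
      (mul_le_mul_of_nonneg_left (dist_coe_le_dist (f := Φ) (g := Ψ) q)
        (setIntegral_Ioi_id_nonneg ν))
  have hint : |(∫ u in Set.Ioi (0:ℝ), jumpExponent ν (Φ (s, Real.log u)) ∂ρ) -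
      ∫ u in Set.Ioi (0:ℝ), jumpExponent ν (Ψ (s, Real.log u)) ∂ρ| ≤ c := by
    rw [← integral_sub (integrableOn_jumpExponent_comp hν Φ s)
      (integrableOn_jumpExponent_comp hν Ψ s)]
    have h := norm_setIntegral_le_of_norm_le_const (μ := ρ) (s := Set.Ioi (0:ℝ))
      (f := fun u => jumpExponent ν (Φ (s, Real.log u)) - jumpExponent ν (Ψ (s, Real.log u)))
      (measure_lt_top _ _) fun u _ => hpt (s, Real.log u)
    exact h.trans (mul_le_of_le_one_right hc measureReal_le_one)
  have h1 := hpt (s, a)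
  rw [abs_le] at h1 hint ⊢
  have hw0 := hw.1
  have hw1 := sub_nonneg.2 hw.2
  unfold riccatiSource
  constructor <;> nlinarith

lemma abs_riccatiSource_le (hν : IntegrableOn (fun z : ℝ => z) (Set.Ioi 0) ν)
    (hw : w ∈ Set.Icc (0:ℝ) 1) (Φ : (ℝ × ℝ) →ᵇ ℝ) (s a : ℝ) :
    |riccatiSource ν ρ w Φ s a| ≤ (∫ z in Set.Ioi (0:ℝ), z ∂ν) * ‖Φ‖ := by
  simpa [riccatiSource, jumpExponent_zero] using abs_riccatiSource_sub_le (ρ := ρ) hν hw Φ 0 s a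

lemma continuous_riccatiLogOp (hν : IntegrableOn (fun z : ℝ => z) (Set.Ioi 0) ν)
    (θ T : ℝ) (Φ : (ℝ × ℝ) →ᵇ ℝ) : Continuous (riccatiLogOp ν ρ w θ T Φ) := by
  have hS := continuous_riccatiSource (ρ := ρ) (w := w) hν Φ
  refine Continuous.add (by fun_prop) ?_
  refine intervalIntegral.continuous_parametric_intervalIntegral_of_continuous
    (f := fun (p : ℝ × ℝ) s => Real.exp (-(Real.exp p.2 * (max 0 (min p.1 T) - s))) *
      Real.exp p.2 * riccatiSource ν ρ w Φ s p.2) ?_ (by fun_prop)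
  exact Continuous.mul (by fun_prop)
    (hS.comp (continuous_snd.prodMk (continuous_snd.comp continuous_fst)))

lemma abs_riccatiLogOp_sub_le (hν : IntegrableOn (fun z : ℝ => z) (Set.Ioi 0) ν)
    (hw : w ∈ Set.Icc (0:ℝ) 1) (θ T : ℝ) (Φ Ψ : (ℝ × ℝ) →ᵇ ℝ) (p : ℝ × ℝ) :
    |riccatiLogOp ν ρ w θ T Φ p - riccatiLogOp ν ρ w θ T Ψ p| ≤
      (∫ z in Set.Ioi (0:ℝ), z ∂ν) * dist Φ Ψ := by
  have hcont : ∀ Φ : (ℝ × ℝ) →ᵇ ℝ, Continuous fun s =>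
      Real.exp (-(Real.exp p.2 * (max 0 (min p.1 T) - s))) * Real.exp p.2 *
        riccatiSource ν ρ w Φ s p.2 := fun Φ =>
    Continuous.mul (by fun_prop) ((continuous_riccatiSource hν Φ).comp
      (continuous_id.prodMk continuous_const))
  unfold riccatiLogOp
  rw [add_sub_add_left_eq_sub, ← intervalIntegral.integral_sub
    ((hcont Φ).intervalIntegrable _ _) ((hcont Ψ).intervalIntegrable _ _)]
  simp_rw [← mul_sub]
  exact abs_integral_exp_kernel_mul_le (Real.exp_pos _).le (le_max_left _ _)
    (mul_nonneg (setIntegral_Ioi_id_nonneg ν) dist_nonneg)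
    fun s => abs_riccatiSource_sub_le hν hw Φ Ψ s p.2

lemma abs_riccatiLogOp_le (hν : IntegrableOn (fun z : ℝ => z) (Set.Ioi 0) ν)
    (hw : w ∈ Set.Icc (0:ℝ) 1) {θ : ℝ} (hθ : 0 ≤ θ) (T : ℝ) (Φ : (ℝ × ℝ) →ᵇ ℝ) (p : ℝ × ℝ) :
    |riccatiLogOp ν ρ w θ T Φ p| ≤ θ + (∫ z in Set.Ioi (0:ℝ), z ∂ν) * ‖Φ‖ := by
  refine (abs_add_le _ _).trans (add_le_add ?_ ?_)
  · rw [abs_of_nonneg (by positivity)]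
    refine mul_le_of_le_one_right hθ (Real.exp_le_one_iff.2 (neg_nonpos.2 ?_))
    exact mul_nonneg (Real.exp_pos _).le (le_max_left _ _)
  · exact abs_integral_exp_kernel_mul_le (Real.exp_pos _).le (le_max_left _ _)
      (mul_nonneg (setIntegral_Ioi_id_nonneg ν) (norm_nonneg _))
      fun s => abs_riccatiSource_le hν hw Φ s p.2

/-- The logarithmic Riccati operator on bounded continuous functions has exactly one
fixed point. -/
lemma existsUnique_riccatiLogOp_fixed (hν : IntegrableOn (fun z : ℝ => z) (Set.Ioi 0) ν)
    (hM : ∫ z in Set.Ioi (0:ℝ), z ∂ν < 1) (hw : w ∈ Set.Icc (0:ℝ) 1) {θ : ℝ} (hθ : 0 ≤ θ)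
    (T : ℝ) : ∃! Φ : (ℝ × ℝ) →ᵇ ℝ, ∀ p, riccatiLogOp ν ρ w θ T Φ p = Φ p := by
  let G : ((ℝ × ℝ) →ᵇ ℝ) → (ℝ × ℝ) →ᵇ ℝ := fun Φ =>
    .ofNormedAddCommGroup (riccatiLogOp ν ρ w θ T Φ) (continuous_riccatiLogOp hν θ T Φ) _
      (abs_riccatiLogOp_le hν hw hθ T Φ)
  have hG : ContractingWith ⟨_, setIntegral_Ioi_id_nonneg ν⟩ G :=
    ⟨hM, LipschitzWith.of_dist_le_mul fun Φ Ψ =>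
      (dist_le (mul_nonneg (setIntegral_Ioi_id_nonneg ν) dist_nonneg)).2
        (abs_riccatiLogOp_sub_le hν hw θ T Φ Ψ)⟩
  refine ⟨ContractingWith.fixedPoint G hG, fun p => DFunLike.congr_fun hG.fixedPoint_isFixedPt p,
    fun Ψ hΨ => hG.fixedPoint_unique ?_⟩
  exact BoundedContinuousFunction.ext hΨ

end

/-- The two forms of the Riccati operator agree on nonnegative functions. -/
lemma riccatiLogOp_eq_riccatiOp {ν ρ : Measure ℝ} {w θ T : ℝ} {Φ : ℝ × ℝ → ℝ} {φ : ℝ → ℝ → ℝ}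
    (hφ : ∀ t ∈ Set.Icc (0:ℝ) T, ∀ r ∈ Set.Ioi (0:ℝ), 0 ≤ φ t r)
    (hΦ : ∀ t ∈ Set.Icc (0:ℝ) T, ∀ r ∈ Set.Ioi (0:ℝ), Φ (t, Real.log r) = φ t r)
    {t r : ℝ} (ht : t ∈ Set.Icc (0:ℝ) T) (hr : 0 < r) :
    riccatiLogOp ν ρ w θ T Φ (t, Real.log r) = riccatiOp ν ρ w θ φ t r := by
  have hτ : max 0 (min t T) = t := by rw [min_eq_left ht.2, max_eq_right ht.1]
  have hg : ∀ s ∈ Set.Icc (0:ℝ) T, ∀ u ∈ Set.Ioi (0:ℝ), jumpExponent ν (Φ (s, Real.log u)) =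
      ∫ z in Set.Ioi (0:ℝ), (1 - Real.exp (-(φ s u * z))) ∂ν := fun s hs u hu => by
    rw [jumpExponent, hΦ s hs u hu, max_eq_left (hφ s hs u hu)]
  simp only [riccatiLogOp, riccatiOp, hτ, Real.exp_log hr]
  congr 1
  refine intervalIntegral.integral_congr fun s hs => ?_
  rw [Set.uIcc_of_le ht.1] at hs
  have hs' : s ∈ Set.Icc (0:ℝ) T := ⟨hs.1, hs.2.trans ht.2⟩
  simp only [riccatiSource]
  rw [hg s hs' r hr, setIntegral_congr_fun measurableSet_Ioi (hg s hs')]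

/-- Existence, uniqueness, nonnegativity and the a priori bound `θ(1-M₁)⁻¹` for the
bounded continuous solution of the mild generalized Riccati equation of the
aggregation model. -/
theorem riccati_existence_uniqueness
    (ν ρ : Measure ℝ) [SigmaFinite ν] [IsProbabilityMeasure ρ]
    (hν : ν (Set.Iic 0) = 0) (hρ : ρ (Set.Iic 0) = 0)
    (hνInt : IntegrableOn (fun z : ℝ => z) (Set.Ioi 0) ν)
    (M₁ : ℝ) (hM₁ : M₁ = ∫ z in Set.Ioi (0:ℝ), z ∂ν)
    (hM₁pos : 0 < M₁) (hM₁lt : M₁ < 1)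
    (w : ℝ) (hw : w ∈ Set.Icc (0:ℝ) 1)
    (θ : ℝ) (hθ : 0 ≤ θ) (T : ℝ) (hT : 0 < T) :
    ∃ φ : ℝ → ℝ → ℝ,
      (ContinuousOn (fun p : ℝ × ℝ => φ p.1 p.2) (Set.Icc 0 T ×ˢ Set.Ioi 0) ∧
       (∃ C : ℝ, ∀ t ∈ Set.Icc (0:ℝ) T, ∀ r ∈ Set.Ioi (0:ℝ), |φ t r| ≤ C) ∧
       (∀ t ∈ Set.Icc (0:ℝ) T, ∀ r ∈ Set.Ioi (0:ℝ), 0 ≤ φ t r) ∧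
       (∀ t ∈ Set.Icc (0:ℝ) T, ∀ r ∈ Set.Ioi (0:ℝ),
         φ t r = riccatiOp ν ρ w θ φ t r) ∧
       (∀ t ∈ Set.Icc (0:ℝ) T, ∀ r ∈ Set.Ioi (0:ℝ), φ t r ≤ θ * (1 - M₁)⁻¹)) ∧
      (∀ ψ : ℝ → ℝ → ℝ,
        ContinuousOn (fun p : ℝ × ℝ => ψ p.1 p.2) (Set.Icc 0 T ×ˢ Set.Ioi 0) →
        (∃ C : ℝ, ∀ t ∈ Set.Icc (0:ℝ) T, ∀ r ∈ Set.Ioi (0:ℝ), |ψ t r| ≤ C) →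
        (∀ t ∈ Set.Icc (0:ℝ) T, ∀ r ∈ Set.Ioi (0:ℝ), 0 ≤ ψ t r) →
        (∀ t ∈ Set.Icc (0:ℝ) T, ∀ r ∈ Set.Ioi (0:ℝ),
          ψ t r = riccatiOp ν ρ w θ ψ t r) →
        ∀ t ∈ Set.Icc (0:ℝ) T, ∀ r ∈ Set.Ioi (0:ℝ), ψ t r = φ t r) := by
  subst hM₁
  obtain ⟨Φ, hfix, huniq⟩ := existsUnique_riccatiLogOp_fixed (ρ := ρ) hνInt hM₁lt hw hθ T
  have hΦ0 : ∀ p, 0 ≤ Φ p := fun p => hfix p ▸ riccatiLogOp_nonneg hw hθ T Φ p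
  have hΦb : ‖Φ‖ ≤ θ * (1 - ∫ z in Set.Ioi (0:ℝ), z ∂ν)⁻¹ := by
    have h : ‖Φ‖ ≤ θ + (∫ z in Set.Ioi (0:ℝ), z ∂ν) * ‖Φ‖ :=
      (BoundedContinuousFunction.norm_le (by positivity)).2 fun p => by
        rw [← hfix p]; exact abs_riccatiLogOp_le hνInt hw hθ T Φ p
    rw [← div_eq_mul_inv, le_div_iff₀ (by linarith)]
    linarith
  refine ⟨fun t r => Φ (t, Real.log r), ⟨?_, ⟨‖Φ‖, fun t _ r _ => Φ.norm_coe_le_norm _⟩,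
    fun t _ r _ => hΦ0 _, fun t ht r hr => ?_,
    fun t _ r _ => ((le_abs_self _).trans (Φ.norm_coe_le_norm _)).trans hΦb⟩, ?_⟩
  · refine Φ.continuous.comp_continuousOn (continuousOn_fst.prodMk ?_)
    exact continuousOn_snd.log fun p hp => ne_of_gt hp.2
  · rw [← riccatiLogOp_eq_riccatiOp (fun _ _ _ _ => hΦ0 _) (fun _ _ _ _ => rfl) ht hr]
    exact (hfix _).symm
  · rintro ψ hcont ⟨C, hC⟩ hψ0 hψ t ht r hr
    have hmem : ∀ t : ℝ, max 0 (min t T) ∈ Set.Icc (0:ℝ) T := fun t =>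
      ⟨le_max_left _ _, max_le hT.le (min_le_right _ _)⟩
    have hclamp : ∀ t ∈ Set.Icc (0:ℝ) T, max 0 (min t T) = t := fun t ht => by
      rw [min_eq_left ht.2, max_eq_right ht.1]
    let Ψ : BoundedContinuousFunction (ℝ × ℝ) ℝ := .ofNormedAddCommGroup
      (fun p => ψ (max 0 (min p.1 T)) (Real.exp p.2))
      (hcont.comp_continuous (f := fun p : ℝ × ℝ => (max 0 (min p.1 T), Real.exp p.2))
        (by fun_prop) fun p => ⟨hmem p.1, Real.exp_pos _⟩)
      C fun p => hC _ (hmem p.1) _ (Real.exp_pos _)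
    have hΨ : ∀ t ∈ Set.Icc (0:ℝ) T, ∀ r ∈ Set.Ioi (0:ℝ), Ψ (t, Real.log r) = ψ t r :=
      fun t ht r hr => by
        change ψ (max 0 (min t T)) (Real.exp (Real.log r)) = ψ t r
        rw [hclamp t ht, Real.exp_log hr]
    have hΨfix : ∀ p, riccatiLogOp ν ρ w θ T Ψ p = Ψ p := fun p => by
      have h := riccatiLogOp_eq_riccatiOp (ν := ν) (ρ := ρ) (w := w) (θ := θ) hψ0 hΨ
        (hmem p.1) (Real.exp_pos p.2)
      rw [← hψ _ (hmem p.1) _ (Real.exp_pos p.2), Real.log_exp] at h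
      refine Eq.trans ?_ h
      simp only [riccatiLogOp, hclamp _ (hmem p.1)]
    rw [← hΨ t ht r hr, huniq Ψ hΨfix]
end

section
/- Let π be a Borel probability measure on (0,∞), let w ∈ [0,1], let M₁ ∈ (0,1) and let T > 0. Then there exists a unique measurable function E : [0,T] × (0,∞) → ℝ with sup_{0≤t≤T} ∫₀^∞ |E(t,r)| π(dr) < ∞ such that for every t ∈ [0,T] and π-almost every r > 0, E(t,r) = e^{−(1−wM₁) r t} + (1−w) M₁ r ∫₀ᵗ e^{−(1−wM₁) r (t−s)} ( ∫₀^∞ E(s,y) π(dy) ) ds; moreover for π-almost every r the map t ↦ E(t,r) is continuous on [0,T]. -/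
open MeasureTheory

/-- The operator associated with the mild form of the first Lyapunov equation of the
aggregation model:
`(𝕋Φ)(t,r) = e^{-(1-wM₁)rt} + (1-w)M₁ r ∫₀ᵗ e^{-(1-wM₁)r(t-s)} (∫ Φ(s,y) π(dy)) ds`. -/
noncomputable def lyapOp (π : Measure ℝ) (w M₁ : ℝ)
    (Φ : ℝ → ℝ → ℝ) (t r : ℝ) : ℝ :=
  Real.exp (-((1 - w * M₁) * r * t)) +
    (1 - w) * M₁ * r *
      ∫ s in (0:ℝ)..t, Real.exp (-((1 - w * M₁) * r * (t - s))) *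
        (∫ y in Set.Ioi (0:ℝ), Φ s y ∂π)

open Set Filter Topology
open scoped BoundedContinuousFunction

/-- The mild solution at time `t` of `y' = r (-a y + b m)`, `y 0 = 1`. -/
noncomputable def mildSolution (a b : ℝ) (m : ℝ → ℝ) (t r : ℝ) : ℝ :=
  Real.exp (-(a * r * t)) + b * r * ∫ s in (0 : ℝ)..t, Real.exp (-(a * r * (t - s))) * m s

lemma lyapOp_eq_mildSolution (π : Measure ℝ) (hπ : π (Iic 0) = 0) (w M₁ : ℝ) (Φ : ℝ → ℝ → ℝ) :
    lyapOp π w M₁ Φ =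
      mildSolution (1 - w * M₁) ((1 - w) * M₁) (fun s => ∫ y, Φ s y ∂π) := by
  have h : π.restrict (Ioi 0) = π := by
    rw [← compl_Iic]
    exact Measure.restrict_eq_self_of_ae_mem (measure_eq_zero_iff_ae_notMem.1 hπ)
  unfold lyapOp
  rw [h]
  rfl

lemma integral_exp_neg_mul_sub {c : ℝ} (hc : c ≠ 0) (t : ℝ) :
    ∫ s in (0 : ℝ)..t, Real.exp (-(c * (t - s))) = (1 - Real.exp (-(c * t))) / c := by
  have hd : ∀ s ∈ uIcc 0 t, HasDerivAt (fun s => Real.exp (-(c * (t - s))) / c)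
      (Real.exp (-(c * (t - s)))) s := by
    intro s _
    refine ((((hasDerivAt_id' s).const_sub t).const_mul c).fun_neg.exp.div_const c).congr_deriv ?_
    field_simp
  rw [intervalIntegral.integral_eq_sub_of_hasDerivAt hd
    (Continuous.intervalIntegrable (by fun_prop) _ _)]
  simp [sub_div]

lemma abs_duhamel_le {a b r t D : ℝ} {f : ℝ → ℝ} (ha : 0 < a) (hb : 0 ≤ b) (hr : 0 < r)
    (ht : 0 ≤ t) (hf : ∀ s ∈ Icc 0 t, |f s| ≤ D) :
    |b * r * ∫ s in (0 : ℝ)..t, Real.exp (-(a * r * (t - s))) * f s| ≤ b / a * D := by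
  have hD : 0 ≤ D := (abs_nonneg _).trans (hf 0 ⟨le_rfl, ht⟩)
  have hc : 0 < a * r := mul_pos ha hr
  have h1 : |∫ s in (0 : ℝ)..t, Real.exp (-(a * r * (t - s))) * f s| ≤
      ∫ s in (0 : ℝ)..t, Real.exp (-(a * r * (t - s))) * D := by
    rw [← Real.norm_eq_abs]
    refine intervalIntegral.norm_integral_le_of_norm_le ht (ae_of_all _ fun s hs => ?_)
      (Continuous.intervalIntegrable (by fun_prop) _ _)
    rw [norm_mul, Real.norm_eq_abs, Real.abs_exp]
    exact mul_le_mul_of_nonneg_left (hf s (Ioc_subset_Icc_self hs)) (Real.exp_pos _).le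
  rw [intervalIntegral.integral_mul_const, integral_exp_neg_mul_sub hc.ne'] at h1
  have h2 : (1 - Real.exp (-(a * r * t))) / (a * r) * D ≤ 1 / (a * r) * D := by
    gcongr
    linarith [Real.exp_pos (-(a * r * t))]
  rw [abs_mul, abs_of_nonneg (mul_nonneg hb hr.le)]
  calc _ ≤ b * r * (1 / (a * r) * D) := by gcongr; exact h1.trans h2
    _ = b / a * D := by field_simp

lemma continuous_mildSolution (a b : ℝ) {m : ℝ → ℝ} (hm : Continuous m) :
    Continuous (fun p : ℝ × ℝ => mildSolution a b m p.1 p.2) := by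
  have h : Continuous (fun p : ℝ × ℝ =>
      ∫ s in (0 : ℝ)..p.1, Real.exp (-(a * p.2 * (p.1 - s))) * m s) :=
    intervalIntegral.continuous_parametric_intervalIntegral_of_continuous
      (f := fun (p : ℝ × ℝ) s => Real.exp (-(a * p.2 * (p.1 - s))) * m s)
      (by fun_prop) continuous_fst
  unfold mildSolution
  fun_prop

lemma abs_mildSolution_le {a b r t D : ℝ} {m : ℝ → ℝ} (ha : 0 < a) (hb : 0 ≤ b) (hr : 0 < r)
    (ht : 0 ≤ t) (hm : ∀ s ∈ Icc 0 t, |m s| ≤ D) :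
    |mildSolution a b m t r| ≤ 1 + b / a * D := by
  refine (abs_add_le _ _).trans (add_le_add ?_ (abs_duhamel_le ha hb hr ht hm))
  rw [Real.abs_exp, Real.exp_le_one_iff]
  have : 0 ≤ a * r * t := by positivity
  linarith

lemma abs_mildSolution_sub_le {a b r t D : ℝ} {m₁ m₂ : ℝ → ℝ} (ha : 0 < a) (hb : 0 ≤ b)
    (hr : 0 < r) (ht : 0 ≤ t) (h₁ : IntervalIntegrable m₁ volume 0 t)
    (h₂ : IntervalIntegrable m₂ volume 0 t) (hm : ∀ s ∈ Icc 0 t, |m₁ s - m₂ s| ≤ D) :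
    |mildSolution a b m₁ t r - mildSolution a b m₂ t r| ≤ b / a * D := by
  have he : ContinuousOn (fun s => Real.exp (-(a * r * (t - s)))) (uIcc 0 t) := by fun_prop
  have := abs_duhamel_le (f := fun s => m₁ s - m₂ s) ha hb hr ht hm
  simp only [mul_sub (Real.exp _)] at this
  rw [intervalIntegral.integral_sub (h₁.continuousOn_mul he) (h₂.continuousOn_mul he),
    mul_sub] at this
  simpa [mildSolution] using this

lemma integrable_mildSolution {μ : Measure ℝ} [IsFiniteMeasure μ] (hμ : ∀ᵐ r ∂μ, 0 < r)
    {a b : ℝ} (ha : 0 < a) (hb : 0 ≤ b) (m : ℝ →ᵇ ℝ) {t : ℝ} (ht : 0 ≤ t) :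
    Integrable (mildSolution a b m t) μ := by
  refine Integrable.of_bound (C := 1 + b / a * ‖m‖) ?_ ?_
  · exact ((continuous_mildSolution a b m.continuous).comp
      (Continuous.prodMk_right t)).aestronglyMeasurable
  · filter_upwards [hμ] with r hr
    exact abs_mildSolution_le ha hb hr ht fun s _ => m.norm_coe_le_norm s

lemma abs_integral_mildSolution_le {μ : Measure ℝ} [IsProbabilityMeasure μ]
    (hμ : ∀ᵐ r ∂μ, 0 < r) {a b : ℝ} (ha : 0 < a) (hb : 0 ≤ b) (m : ℝ →ᵇ ℝ) {t : ℝ}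
    (ht : 0 ≤ t) : ‖∫ r, mildSolution a b m t r ∂μ‖ ≤ 1 + b / a * ‖m‖ := by
  have h : ∀ᵐ r ∂μ, ‖mildSolution a b m t r‖ ≤ 1 + b / a * ‖m‖ := by
    filter_upwards [hμ] with r hr
    exact abs_mildSolution_le ha hb hr ht fun s _ => m.norm_coe_le_norm s
  simpa using norm_integral_le_of_norm_le_const h

/-- The map `m ↦ (t ↦ ∫ mildSolution a b m t⁺ r μ(dr))` on bounded continuous functions. -/
noncomputable def meanMildSolution (μ : Measure ℝ) [IsProbabilityMeasure μ]
    (hμ : ∀ᵐ r ∂μ, 0 < r) {a b : ℝ} (ha : 0 < a) (hb : 0 ≤ b) (m : ℝ →ᵇ ℝ) : ℝ →ᵇ ℝ :=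
  BoundedContinuousFunction.ofNormedAddCommGroup
    (fun t => ∫ r, mildSolution a b m (max t 0) r ∂μ)
    (by
      refine continuous_of_dominated (bound := fun _ => 1 + b / a * ‖m‖) (fun t => ?_)
        (fun t => ?_) (integrable_const _) (ae_of_all _ fun r => ?_)
      · exact (integrable_mildSolution hμ ha hb m (le_max_right t 0)).aestronglyMeasurable
      · filter_upwards [hμ] with r hr
        exact abs_mildSolution_le ha hb hr (le_max_right t 0) fun s _ => m.norm_coe_le_norm s
      · exact (continuous_mildSolution a b m.continuous).comp
          (((continuous_id.max continuous_const)).prodMk continuous_const))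
    (1 + b / a * ‖m‖)
    (fun t => abs_integral_mildSolution_le hμ ha hb m (le_max_right t 0))

lemma exists_eq_integral_mildSolution {μ : Measure ℝ} [IsProbabilityMeasure μ]
    (hμ : ∀ᵐ r ∂μ, 0 < r) {a b : ℝ} (ha : 0 < a) (hb : 0 ≤ b) (hba : b < a) :
    ∃ m : ℝ →ᵇ ℝ, ∀ t, 0 ≤ t → ∫ r, mildSolution a b m t r ∂μ = m t := by
  have hc : ContractingWith (b / a).toNNReal (meanMildSolution μ hμ ha hb) := by
    refine ⟨by rw [Real.toNNReal_lt_one]; exact (div_lt_one ha).2 hba, ?_⟩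
    refine LipschitzWith.of_dist_le_mul fun m₁ m₂ => ?_
    rw [Real.coe_toNNReal _ (div_nonneg hb ha.le),
      BoundedContinuousFunction.dist_le (by positivity)]
    intro t
    have ht := le_max_right t 0
    change |(∫ r, mildSolution a b m₁ (max t 0) r ∂μ) -
      ∫ r, mildSolution a b m₂ (max t 0) r ∂μ| ≤ _
    rw [← integral_sub (integrable_mildSolution hμ ha hb m₁ ht)
      (integrable_mildSolution hμ ha hb m₂ ht)]
    have h : ∀ᵐ r ∂μ, ‖mildSolution a b m₁ (max t 0) r - mildSolution a b m₂ (max t 0) r‖ ≤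
        b / a * dist m₁ m₂ := by
      filter_upwards [hμ] with r hr
      exact abs_mildSolution_sub_le ha hb hr ht (m₁.continuous.intervalIntegrable _ _)
        (m₂.continuous.intervalIntegrable _ _)
        fun s _ => BoundedContinuousFunction.dist_coe_le_dist (f := m₁) (g := m₂) s
    simpa using norm_integral_le_of_norm_le_const h
  refine ⟨hc.fixedPoint _, fun t ht => ?_⟩
  have := DFunLike.congr_fun hc.fixedPoint_isFixedPt t
  change ∫ r, mildSolution a b _ (max t 0) r ∂μ = _ at this
  rwa [max_eq_left ht] at this

lemma eqOn_of_eq_integral_mildSolution {μ : Measure ℝ} [IsProbabilityMeasure μ]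
    (hμ : ∀ᵐ r ∂μ, 0 < r) {a b T C : ℝ} (ha : 0 < a) (hb : 0 ≤ b) (hba : b < a)
    {m : ℝ →ᵇ ℝ} {m' : ℝ → ℝ} (hm : ∀ t, 0 ≤ t → ∫ r, mildSolution a b m t r ∂μ = m t)
    (hint : ∀ t ∈ Icc 0 T, Integrable (mildSolution a b m' t) μ)
    (hm'_meas : AEStronglyMeasurable m') (hm'_bdd : ∀ t ∈ Icc 0 T, |m' t| ≤ C)
    (hm' : ∀ t ∈ Icc 0 T, ∫ r, mildSolution a b m' t r ∂μ = m' t) :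
    EqOn m' m (Icc 0 T) := by
  have hstep : ∀ D, (∀ s ∈ Icc 0 T, |m' s - m s| ≤ D) →
      ∀ t ∈ Icc 0 T, |m' t - m t| ≤ b / a * D := by
    intro D hD t ht
    have hm'_int : IntervalIntegrable m' volume 0 t := by
      rw [intervalIntegrable_iff_integrableOn_Icc_of_le ht.1]
      refine Measure.integrableOn_of_bounded (M := C) (by simp) hm'_meas ?_
      filter_upwards [ae_restrict_mem measurableSet_Icc] with s hs
      exact hm'_bdd s ⟨hs.1, hs.2.trans ht.2⟩
    rw [← hm t ht.1, ← hm' t ht,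
      ← integral_sub (hint t ht) (integrable_mildSolution hμ ha hb m ht.1)]
    have h : ∀ᵐ r ∂μ, ‖mildSolution a b m' t r - mildSolution a b m t r‖ ≤ b / a * D := by
      filter_upwards [hμ] with r hr
      exact abs_mildSolution_sub_le ha hb hr ht.1 hm'_int (m.continuous.intervalIntegrable _ _)
        fun s hs => hD s ⟨hs.1, hs.2.trans ht.2⟩
    simpa using norm_integral_le_of_norm_le_const h
  have hpow : ∀ n : ℕ, ∀ t ∈ Icc 0 T, |m' t - m t| ≤ (b / a) ^ n * (C + ‖m‖) := by
    intro n
    induction n with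
    | zero =>
      intro t ht
      rw [pow_zero, one_mul]
      exact (abs_sub _ _).trans (add_le_add (hm'_bdd t ht) (m.norm_coe_le_norm t))
    | succ n ih =>
      intro t ht
      rw [pow_succ', mul_assoc]
      exact hstep _ ih t ht
  intro t ht
  have hlim : Tendsto (fun n : ℕ => (b / a) ^ n * (C + ‖m‖)) atTop (𝓝 0) := by
    simpa using (tendsto_pow_atTop_nhds_zero_of_lt_one (div_nonneg hb ha.le)
      ((div_lt_one ha).2 hba)).mul_const (C + ‖m‖)
  have h0 : |m' t - m t| ≤ 0 := ge_of_tendsto' hlim fun n => hpow n t ht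
  exact sub_eq_zero.1 (abs_nonpos_iff.1 h0)

lemma mildSolution_congr {a b t r : ℝ} {m₁ m₂ : ℝ → ℝ} (ht : 0 ≤ t)
    (h : EqOn m₁ m₂ (Icc 0 t)) : mildSolution a b m₁ t r = mildSolution a b m₂ t r := by
  unfold mildSolution
  congr 2
  refine intervalIntegral.integral_congr fun s hs => ?_
  rw [uIcc_of_le ht] at hs
  simp only [h hs]

/-- Well-posedness of the first Lyapunov equation of the aggregation model in the
space of (time-uniformly) `π`-integrable functions, together with continuity in time. -/
theorem lyapunov_first_wellposed
    (π : Measure ℝ) [IsProbabilityMeasure π] (hπ : π (Set.Iic 0) = 0)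
    (w : ℝ) (hw : w ∈ Set.Icc (0:ℝ) 1)
    (M₁ : ℝ) (hM₁ : M₁ ∈ Set.Ioo (0:ℝ) 1)
    (T : ℝ) (hT : 0 < T) :
    ∃ E : ℝ → ℝ → ℝ,
      (Measurable (fun p : ℝ × ℝ => E p.1 p.2) ∧
       (∀ t ∈ Set.Icc (0:ℝ) T, IntegrableOn (fun r => E t r) (Set.Ioi 0) π) ∧
       (∃ C : ℝ, ∀ t ∈ Set.Icc (0:ℝ) T, ∫ r in Set.Ioi (0:ℝ), |E t r| ∂π ≤ C) ∧
       (∀ t ∈ Set.Icc (0:ℝ) T, ∀ᵐ r ∂π, E t r = lyapOp π w M₁ E t r) ∧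
       (∀ᵐ r ∂π, ContinuousOn (fun t => E t r) (Set.Icc 0 T))) ∧
      (∀ E' : ℝ → ℝ → ℝ,
        Measurable (fun p : ℝ × ℝ => E' p.1 p.2) →
        (∀ t ∈ Set.Icc (0:ℝ) T, IntegrableOn (fun r => E' t r) (Set.Ioi 0) π) →
        (∃ C : ℝ, ∀ t ∈ Set.Icc (0:ℝ) T, ∫ r in Set.Ioi (0:ℝ), |E' t r| ∂π ≤ C) →
        (∀ t ∈ Set.Icc (0:ℝ) T, ∀ᵐ r ∂π, E' t r = lyapOp π w M₁ E' t r) →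
        ∀ t ∈ Set.Icc (0:ℝ) T, ∀ᵐ r ∂π, E' t r = E t r) := by
  have hμ : ∀ᵐ r ∂π, 0 < r := by
    filter_upwards [measure_eq_zero_iff_ae_notMem.1 hπ] with r hr
    simpa using hr
  have hres : π.restrict (Ioi 0) = π := Measure.restrict_eq_self_of_ae_mem hμ
  have hb : 0 ≤ (1 - w) * M₁ := mul_nonneg (by linarith [hw.2]) hM₁.1.le
  have hba : (1 - w) * M₁ < 1 - w * M₁ := by linarith [hM₁.2]
  have ha : 0 < 1 - w * M₁ := hb.trans_lt hba
  obtain ⟨m, hm⟩ := exists_eq_integral_mildSolution hμ ha hb hba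
  simp only [IntegrableOn, hres, lyapOp_eq_mildSolution π hπ]
  set a := 1 - w * M₁
  set b := (1 - w) * M₁
  have hcont := continuous_mildSolution a b m.continuous
  refine ⟨mildSolution a b m, ⟨hcont.measurable,
    fun t ht => integrable_mildSolution hμ ha hb m ht.1, ⟨1 + b / a * ‖m‖, fun t ht => ?_⟩,
    fun t ht => ae_of_all _ fun r => ?_, ae_of_all _ fun r => ?_⟩, ?_⟩
  · have h : ∀ᵐ r ∂π, ‖|mildSolution a b m t r|‖ ≤ 1 + b / a * ‖m‖ := by
      filter_upwards [hμ] with r hr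
      rw [Real.norm_eq_abs, abs_abs]
      exact abs_mildSolution_le ha hb hr ht.1 fun s _ => m.norm_coe_le_norm s
    simpa using (le_abs_self _).trans (norm_integral_le_of_norm_le_const h)
  · exact mildSolution_congr ht.1 fun s hs => (hm s hs.1).symm
  · exact (hcont.comp (Continuous.prodMk_left r)).continuousOn
  · intro E' hmeas hint ⟨C, hC⟩ hE' t ht
    have heq : EqOn (fun s => ∫ y, E' s y ∂π) m (Icc 0 T) := by
      refine eqOn_of_eq_integral_mildSolution (C := C) hμ ha hb hba hm
        (fun t ht => (hint t ht).congr (hE' t ht)) ?_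
        (fun t ht => (abs_integral_le_integral_abs).trans (hC t ht))
        (fun t ht => (integral_congr_ae (hE' t ht)).symm)
      exact hmeas.stronglyMeasurable.integral_prod_right.aestronglyMeasurable
    filter_upwards [hE' t ht] with r hr
    rw [hr]
    exact mildSolution_congr ht.1 (heq.mono (Icc_subset_Icc_right ht.2))
end

section
/- Let π be a Borel probability measure on (0,∞), let w ∈ [0,1], let M₁ ∈ (0,1), M₂ ≥ 0 and T > 0, and let E₁ : [0,T] × (0,∞) → ℝ be a measurable function satisfying |E₁(t,r)| ≤ (1−wM₁)/(1−M₁) for all t ∈ [0,T] and π-almost every r > 0. Then there exists a unique measurable function E₂ : [0,T] × (0,∞) → ℝ with sup_{0≤t≤T} ∫₀^∞ |E₂(t,r)| π(dr) < ∞ such that for every t ∈ [0,T] and π-almost every r > 0, E₂(t,r) = ∫₀ᵗ e^{−(1−wM₁) r (t−s)} r [ (1−w) M₁ ∫₀^∞ E₂(s,y) π(dy) + M₂ ( w E₁(s,r)² + (1−w) ∫₀^∞ E₁(s,y)² π(dy) ) ] ds; moreover for π-almost every r the map t ↦ E₂(t,r) is continuous on [0,T]. -/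
open MeasureTheory

/-- The operator associated with the mild form of the second Lyapunov equation of the
aggregation model (zero initial condition, source term `E₁`):
`(t,r) ↦ ∫₀ᵗ e^{-(1-wM₁)r(t-s)} r [ (1-w)M₁ ∫ E₂(s,y) π(dy)
  + M₂ ( w E₁(s,r)² + (1-w) ∫ E₁(s,y)² π(dy) ) ] ds`. -/
noncomputable def lyap2Op (π : Measure ℝ) (w M₁ M₂ : ℝ)
    (E₁ E₂ : ℝ → ℝ → ℝ) (t r : ℝ) : ℝ :=
  ∫ s in (0:ℝ)..t, Real.exp (-((1 - w * M₁) * r * (t - s))) * r *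
    ((1 - w) * M₁ * (∫ y in Set.Ioi (0:ℝ), E₂ s y ∂π) +
     M₂ * (w * (E₁ s r) ^ 2 + (1 - w) * ∫ y in Set.Ioi (0:ℝ), (E₁ s y) ^ 2 ∂π))

/-- The Duhamel integral with relaxation rate `a * r` of the rate-weighted source `r * h s r`. -/
noncomputable def duhamel (a : ℝ) (h : ℝ → ℝ → ℝ) (t r : ℝ) : ℝ :=
  ∫ s in (0:ℝ)..t, Real.exp (-(a * r * (t - s))) * r * h s r

lemma intervalIntegrable_of_measurable_of_abs_le {f : ℝ → ℝ} {x y K : ℝ} (hf : Measurable f)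
    (hK : ∀ s ∈ Set.uIoc x y, |f s| ≤ K) : IntervalIntegrable f volume x y := by
  rw [intervalIntegrable_iff]
  exact Measure.integrableOn_of_bounded (by simp [Set.uIoc]) hf.aestronglyMeasurable
    (M := K) ((ae_restrict_iff' measurableSet_uIoc).2 (.of_forall hK))

lemma intervalIntegrable_duhamel_kernel {a t r K : ℝ} {f : ℝ → ℝ} (ht : 0 ≤ t)
    (hf : Measurable f) (hK : ∀ s ∈ Set.Icc 0 t, |f s| ≤ K) :
    IntervalIntegrable (fun s => Real.exp (-(a * r * (t - s))) * r * f s) volume 0 t := by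
  refine (intervalIntegrable_of_measurable_of_abs_le (K := K) hf fun s hs => ?_).continuousOn_mul
    (by fun_prop)
  rw [Set.uIoc_of_le ht] at hs
  exact hK s ⟨hs.1.le, hs.2⟩

lemma abs_duhamel_le_s2 {a t r K : ℝ} {h : ℝ → ℝ → ℝ} (ha : 0 < a) (hr : 0 < r) (ht : 0 ≤ t)
    (hK₀ : 0 ≤ K) (hK : ∀ s ∈ Set.Icc 0 t, |h s r| ≤ K) : |duhamel a h t r| ≤ K / a := by
  have hint : ∫ s in (0:ℝ)..t, Real.exp (-(a * r * (t - s))) * r * K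
      = K / a - Real.exp (-(a * r * t)) * (K / a) := by
    rw [intervalIntegral.integral_eq_sub_of_hasDerivAt
      (f := fun s => Real.exp (-(a * r * (t - s))) * (K / a))]
    · simp
    · intro s _
      have := ((((hasDerivAt_id s).const_sub t).const_mul (a * r)).neg.exp).mul_const (K / a)
      refine this.congr_deriv ?_
      field_simp
      exact mul_comm _ _
    · exact Continuous.intervalIntegrable (by fun_prop) _ _
  have hle := intervalIntegral.norm_integral_le_of_norm_le (μ := volume)
    (f := fun s => Real.exp (-(a * r * (t - s))) * r * h s r)
    (g := fun s => Real.exp (-(a * r * (t - s))) * r * K) ht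
    (.of_forall fun s hs => by
      rw [Real.norm_eq_abs, abs_mul, abs_of_pos (by positivity)]
      exact mul_le_mul_of_nonneg_left (hK s ⟨hs.1.le, hs.2⟩) (by positivity))
    (Continuous.intervalIntegrable (by fun_prop) _ _)
  rw [hint, Real.norm_eq_abs] at hle
  have : 0 ≤ Real.exp (-(a * r * t)) * (K / a) := by positivity
  exact hle.trans (by linarith)

lemma continuous_duhamel {a r K : ℝ} {h : ℝ → ℝ → ℝ}
    (hh : Measurable fun p : ℝ × ℝ => h p.1 p.2) (hK : ∀ s, |h s r| ≤ K) :
    Continuous fun t => duhamel a h t r := by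
  have hm : Measurable fun s => h s r := by fun_prop
  have heq : (fun t => duhamel a h t r) = fun t =>
      Real.exp (-(a * r * t)) * ∫ s in (0:ℝ)..t, (Real.exp (a * r * s) * r) * h s r := by
    ext t
    rw [duhamel, ← intervalIntegral.integral_const_mul]
    congr 1 with s
    rw [show -(a * r * (t - s)) = -(a * r * t) + a * r * s by ring, Real.exp_add]
    ring
  rw [heq]
  refine Continuous.mul (by fun_prop) (intervalIntegral.continuous_primitive (fun x y => ?_) 0)
  exact (intervalIntegrable_of_measurable_of_abs_le (K := K) hm fun s _ => hK s).continuousOn_mul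
    (by fun_prop)

lemma measurable_duhamel_right {a : ℝ} {h : ℝ → ℝ → ℝ}
    (hm : Measurable fun p : ℝ × ℝ => h p.1 p.2) (t : ℝ) : Measurable (duhamel a h t) := by
  have hker : StronglyMeasurable
      (Function.uncurry fun s r => Real.exp (-(a * r * (t - s))) * r * h s r) :=
    Measurable.stronglyMeasurable (by unfold Function.uncurry; fun_prop)
  exact (hker.integral_prod_left (μ := volume.restrict (Set.Ioc 0 t))).measurable.sub
    (hker.integral_prod_left (μ := volume.restrict (Set.Ioc t 0))).measurable

lemma measurable_duhamel {a K : ℝ} {h : ℝ → ℝ → ℝ}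
    (hm : Measurable fun p : ℝ × ℝ => h p.1 p.2) (hK : ∀ s r, |h s r| ≤ K) :
    Measurable fun p : ℝ × ℝ => duhamel a h p.1 p.2 :=
  measurable_uncurry_of_continuous_of_measurable (u := fun t r => duhamel a h t r)
    (fun r => continuous_duhamel hm (hK · r)) (measurable_duhamel_right hm)

lemma integrable_duhamel {π : Measure ℝ} [IsFiniteMeasure π] (hπ : ∀ᵐ r ∂π, 0 < r)
    {a t K : ℝ} {h : ℝ → ℝ → ℝ} (ha : 0 < a) (ht : 0 ≤ t) (hK₀ : 0 ≤ K)
    (hm : Measurable fun p : ℝ × ℝ => h p.1 p.2) (hK : ∀ s ∈ Set.Icc 0 t, ∀ r, |h s r| ≤ K) :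
    Integrable (duhamel a h t) π :=
  .of_bound (measurable_duhamel_right hm t).aestronglyMeasurable (K / a)
    (hπ.mono fun _ hr => abs_duhamel_le_s2 ha hr ht hK₀ fun s hs => hK s hs _)

lemma integral_abs_duhamel_le {π : Measure ℝ} [IsProbabilityMeasure π] (hπ : ∀ᵐ r ∂π, 0 < r)
    {a t K : ℝ} {h : ℝ → ℝ → ℝ} (ha : 0 < a) (ht : 0 ≤ t) (hK₀ : 0 ≤ K)
    (hK : ∀ s ∈ Set.Icc 0 t, ∀ r, |h s r| ≤ K) :
    ∫ r, |duhamel a h t r| ∂π ≤ K / a := by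
  have := norm_integral_le_of_norm_le_const (μ := π) (f := fun r => |duhamel a h t r|) (C := K / a)
    (hπ.mono fun r hr => by
      simpa using abs_duhamel_le_s2 ha hr ht hK₀ fun s hs => hK s hs r)
  simp only [probReal_univ, mul_one] at this
  exact (le_abs_self _).trans this

lemma abs_integral_duhamel_sub_le {π : Measure ℝ} [IsProbabilityMeasure π]
    (hπ : ∀ᵐ r ∂π, 0 < r) {a c t δ K₁ K₂ G : ℝ} {g : ℝ → ℝ → ℝ} {m₁ m₂ : ℝ → ℝ}
    (ha : 0 < a) (hc : 0 ≤ c) (ht : 0 ≤ t)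
    (hg : Measurable fun p : ℝ × ℝ => g p.1 p.2) (hG : ∀ s r, |g s r| ≤ G)
    (hm₁ : Measurable m₁) (hm₂ : Measurable m₂)
    (hK₁ : ∀ s ∈ Set.Icc 0 t, |m₁ s| ≤ K₁) (hK₂ : ∀ s ∈ Set.Icc 0 t, |m₂ s| ≤ K₂)
    (hδ : ∀ s ∈ Set.Icc 0 t, |m₁ s - m₂ s| ≤ δ) :
    |∫ r, duhamel a (fun s r => c * m₁ s + g s r) t r ∂π
      - ∫ r, duhamel a (fun s r => c * m₂ s + g s r) t r ∂π| ≤ c / a * δ := by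
  have bd : ∀ {m : ℝ → ℝ} {K : ℝ}, (∀ s ∈ Set.Icc 0 t, |m s| ≤ K) →
      ∀ s ∈ Set.Icc 0 t, ∀ r, |c * m s + g s r| ≤ c * K + G := fun hK s hs r =>
    (abs_add_le _ _).trans (add_le_add
      (by rw [abs_mul, abs_of_nonneg hc]; exact mul_le_mul_of_nonneg_left (hK s hs) hc) (hG s r))
  have h0 : (0:ℝ) ∈ Set.Icc 0 t := ⟨le_rfl, ht⟩
  have hδ₀ : 0 ≤ δ := (abs_nonneg _).trans (hδ 0 h0)
  have hi₁ := integrable_duhamel (h := fun s r => c * m₁ s + g s r) hπ ha ht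
    ((abs_nonneg _).trans (bd hK₁ 0 h0 0)) (by fun_prop) (bd hK₁)
  have hi₂ := integrable_duhamel (h := fun s r => c * m₂ s + g s r) hπ ha ht
    ((abs_nonneg _).trans (bd hK₂ 0 h0 0)) (by fun_prop) (bd hK₂)
  rw [← integral_sub hi₁ hi₂]
  have hdiff : ∀ r, duhamel a (fun s r => c * m₁ s + g s r) t r
      - duhamel a (fun s r => c * m₂ s + g s r) t r
      = duhamel a (fun s _ => c * (m₁ s - m₂ s)) t r := by
    intro r
    unfold duhamel
    rw [← intervalIntegral.integral_sub
      (intervalIntegrable_duhamel_kernel ht (by fun_prop) (bd hK₁ · · r))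
      (intervalIntegrable_duhamel_kernel ht (by fun_prop) (bd hK₂ · · r))]
    congr 1 with s
    ring
  simp_rw [hdiff]
  have hle := integral_abs_duhamel_le (h := fun s _ => c * (m₁ s - m₂ s)) (K := c * δ)
    hπ ha ht (by positivity) (fun s hs _ => by
      rw [abs_mul, abs_of_nonneg hc]; exact mul_le_mul_of_nonneg_left (hδ s hs) hc)
  calc _ ≤ _ := abs_integral_le_integral_abs
    _ ≤ _ := hle
    _ = _ := by ring

/-- By the contraction principle with constant `c / a`, the equation for the mean is solvable. -/
lemma exists_mean_eq_integral_duhamel {π : Measure ℝ} [IsProbabilityMeasure π]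
    (hπ : ∀ᵐ r ∂π, 0 < r) {a c G : ℝ} {g : ℝ → ℝ → ℝ} (ha : 0 < a) (hc : 0 ≤ c) (hca : c < a)
    (hg : Measurable fun p : ℝ × ℝ => g p.1 p.2) (hG : ∀ s r, |g s r| ≤ G) :
    ∃ m : BoundedContinuousFunction ℝ ℝ, ∀ t, 0 ≤ t →
      m t = ∫ r, duhamel a (fun s r => c * m s + g s r) t r ∂π := by
  have bd : ∀ (m : BoundedContinuousFunction ℝ ℝ) (s r : ℝ),
      |c * m s + g s r| ≤ c * ‖m‖ + G := fun m s r =>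
    (abs_add_le _ _).trans (add_le_add
      (by rw [abs_mul, abs_of_nonneg hc]
          exact mul_le_mul_of_nonneg_left (m.norm_coe_le_norm s) hc) (hG s r))
  have bd₀ : ∀ m : BoundedContinuousFunction ℝ ℝ, 0 ≤ c * ‖m‖ + G := fun m =>
    (abs_nonneg _).trans (bd m 0 0)
  have hmeas : ∀ m : BoundedContinuousFunction ℝ ℝ,
      Measurable fun p : ℝ × ℝ => c * m p.1 + g p.1 p.2 := fun m => by
    have := m.continuous.measurable
    fun_prop
  let Φ : BoundedContinuousFunction ℝ ℝ → BoundedContinuousFunction ℝ ℝ := fun m =>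
    .ofNormedAddCommGroup
      (fun t => ∫ r, duhamel a (fun s r => c * m s + g s r) (max t 0) r ∂π)
      (continuous_of_dominated (bound := fun _ => (c * ‖m‖ + G) / a)
        (fun t => (measurable_duhamel_right (hmeas m) _).aestronglyMeasurable)
        (fun t => hπ.mono fun r hr =>
          abs_duhamel_le_s2 ha hr (le_max_right _ _) (bd₀ m) fun s _ => bd m s r)
        (integrable_const _)
        (.of_forall fun r => (continuous_duhamel (h := fun s r => c * m s + g s r)
          (hmeas m) (bd m · r)).comp (by fun_prop : Continuous fun t : ℝ => max t 0)))
      ((c * ‖m‖ + G) / a)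
      (fun t => abs_integral_le_integral_abs.trans
        (integral_abs_duhamel_le hπ ha (le_max_right _ _) (bd₀ m) fun s _ => bd m s))
  have hq : 0 ≤ c / a := by positivity
  have hq : 0 ≤ c / a := by positivity
  have hq : 0 ≤ c / a := by positivity
  have hΦ : ContractingWith (c / a).toNNReal Φ := by
    refine ⟨Real.toNNReal_lt_one.2 ((div_lt_one ha).2 hca), .of_dist_le_mul fun m₁ m₂ => ?_⟩
    rw [Real.coe_toNNReal _ hq]
    refine (BoundedContinuousFunction.dist_le (mul_nonneg hq dist_nonneg)).2 fun t => ?_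
    exact abs_integral_duhamel_sub_le hπ ha hc (le_max_right _ _) hg hG
      m₁.continuous.measurable m₂.continuous.measurable
      (fun s _ => m₁.norm_coe_le_norm s) (fun s _ => m₂.norm_coe_le_norm s)
      (fun s _ => BoundedContinuousFunction.dist_coe_le_dist (f := m₁) (g := m₂) s)
  refine ⟨hΦ.fixedPoint Φ, fun t ht => ?_⟩
  have h := DFunLike.congr_fun hΦ.fixedPoint_isFixedPt t
  rw [← h]
  change ∫ r, duhamel a (fun s r => c * hΦ.fixedPoint Φ s + g s r) (max t 0) r ∂π = _
  rw [max_eq_left ht]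

lemma eq_of_eq_integral_duhamel {π : Measure ℝ} [IsProbabilityMeasure π]
    (hπ : ∀ᵐ r ∂π, 0 < r) {a c G K₁ K₂ T : ℝ} {g : ℝ → ℝ → ℝ} {m₁ m₂ : ℝ → ℝ}
    (ha : 0 < a) (hc : 0 ≤ c) (hca : c < a)
    (hg : Measurable fun p : ℝ × ℝ => g p.1 p.2) (hG : ∀ s r, |g s r| ≤ G)
    (hm₁ : Measurable m₁) (hm₂ : Measurable m₂)
    (hK₁ : ∀ s ∈ Set.Icc 0 T, |m₁ s| ≤ K₁) (hK₂ : ∀ s ∈ Set.Icc 0 T, |m₂ s| ≤ K₂)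
    (h₁ : ∀ t ∈ Set.Icc 0 T, m₁ t = ∫ r, duhamel a (fun s r => c * m₁ s + g s r) t r ∂π)
    (h₂ : ∀ t ∈ Set.Icc 0 T, m₂ t = ∫ r, duhamel a (fun s r => c * m₂ s + g s r) t r ∂π) :
    ∀ t ∈ Set.Icc 0 T, m₁ t = m₂ t := by
  have hpow : ∀ n : ℕ, ∀ t ∈ Set.Icc 0 T, |m₁ t - m₂ t| ≤ (c / a) ^ n * (K₁ + K₂) := by
    intro n
    induction n with
    | zero =>
      intro t ht
      have := (abs_sub _ _).trans (add_le_add (hK₁ t ht) (hK₂ t ht))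
      simpa using this
    | succ n ih =>
      intro t ht
      have hsub : Set.Icc 0 t ⊆ Set.Icc 0 T := Set.Icc_subset_Icc_right ht.2
      rw [h₁ t ht, h₂ t ht, pow_succ', mul_assoc]
      exact abs_integral_duhamel_sub_le hπ ha hc ht.1 hg hG hm₁ hm₂
        (fun s hs => hK₁ s (hsub hs)) (fun s hs => hK₂ s (hsub hs)) (fun s hs => ih s (hsub hs))
  intro t ht
  have hlim := (tendsto_pow_atTop_nhds_zero_of_lt_one (by positivity)
    ((div_lt_one ha).2 hca)).mul_const (K₁ + K₂)
  rw [zero_mul] at hlim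
  have := ge_of_tendsto' hlim fun n => hpow n t ht
  exact sub_eq_zero.1 (abs_nonpos_iff.1 this)

/-- Well-posedness of the second Lyapunov equation of the aggregation model, with a
given bounded measurable source term `E₁`, in the space of (time-uniformly)
`π`-integrable functions, together with continuity in time. -/
theorem lyapunov_second_wellposed
    (π : Measure ℝ) [IsProbabilityMeasure π] (hπ : π (Set.Iic 0) = 0)
    (w : ℝ) (hw : w ∈ Set.Icc (0:ℝ) 1)
    (M₁ : ℝ) (hM₁ : M₁ ∈ Set.Ioo (0:ℝ) 1) (M₂ : ℝ) (hM₂ : 0 ≤ M₂)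
    (T : ℝ) (hT : 0 < T)
    (E₁ : ℝ → ℝ → ℝ) (hE₁meas : Measurable (fun p : ℝ × ℝ => E₁ p.1 p.2))
    (hE₁bdd : ∀ t ∈ Set.Icc (0:ℝ) T, ∀ᵐ r ∂π, |E₁ t r| ≤ (1 - w * M₁) / (1 - M₁)) :
    ∃ E₂ : ℝ → ℝ → ℝ,
      (Measurable (fun p : ℝ × ℝ => E₂ p.1 p.2) ∧
       (∀ t ∈ Set.Icc (0:ℝ) T, IntegrableOn (fun r => E₂ t r) (Set.Ioi 0) π) ∧
       (∃ C : ℝ, ∀ t ∈ Set.Icc (0:ℝ) T, ∫ r in Set.Ioi (0:ℝ), |E₂ t r| ∂π ≤ C) ∧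
       (∀ t ∈ Set.Icc (0:ℝ) T, ∀ᵐ r ∂π, E₂ t r = lyap2Op π w M₁ M₂ E₁ E₂ t r) ∧
       (∀ᵐ r ∂π, ContinuousOn (fun t => E₂ t r) (Set.Icc 0 T))) ∧
      (∀ E₂' : ℝ → ℝ → ℝ,
        Measurable (fun p : ℝ × ℝ => E₂' p.1 p.2) →
        (∀ t ∈ Set.Icc (0:ℝ) T, IntegrableOn (fun r => E₂' t r) (Set.Ioi 0) π) →
        (∃ C : ℝ, ∀ t ∈ Set.Icc (0:ℝ) T, ∫ r in Set.Ioi (0:ℝ), |E₂' t r| ∂π ≤ C) →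
        (∀ t ∈ Set.Icc (0:ℝ) T, ∀ᵐ r ∂π, E₂' t r = lyap2Op π w M₁ M₂ E₁ E₂' t r) →
        ∀ t ∈ Set.Icc (0:ℝ) T, ∀ᵐ r ∂π, E₂' t r = E₂ t r) := by
  obtain ⟨hw₀, hw₁⟩ := hw
  obtain ⟨hM₀, hM₁'⟩ := hM₁
  have ha : 0 < 1 - w * M₁ := by nlinarith
  have hc : 0 ≤ (1 - w) * M₁ := mul_nonneg (by linarith) hM₀.le
  have hca : (1 - w) * M₁ < 1 - w * M₁ := by nlinarith
  have hpos : ∀ᵐ r ∂π, 0 < r := by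
    rw [ae_iff]
    simpa [Set.Iic] using hπ
  have hres : π.restrict (Set.Ioi 0) = π := Measure.restrict_eq_self_of_ae_mem hpos
  set B := (1 - w * M₁) / (1 - M₁)
  have hB : 0 ≤ B := div_nonneg ha.le (by linarith)
  -- Truncating `E₁` gives an everywhere bounded source agreeing with it almost everywhere.
  set F : ℝ → ℝ → ℝ := fun t r => max (-B) (min (E₁ t r) B) with hF
  have hFm : Measurable fun p : ℝ × ℝ => F p.1 p.2 :=
    measurable_const.max (hE₁meas.min measurable_const)
  have hFB : ∀ t r, |F t r| ≤ B := fun t r =>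
    abs_le.2 ⟨le_max_left _ _, max_le (by linarith) (min_le_right _ _)⟩
  have hFsq : ∀ t r, |F t r ^ 2| ≤ B ^ 2 := fun t r => by
    rw [abs_pow]
    exact pow_le_pow_left₀ (abs_nonneg _) (hFB t r) 2
  have hFE : ∀ t ∈ Set.Icc (0:ℝ) T, ∀ᵐ r ∂π, E₁ t r = F t r := fun t ht =>
    (hE₁bdd t ht).mono fun r hr => by
      rw [hF]
      simp only [min_eq_left (abs_le.1 hr).2, max_eq_right (abs_le.1 hr).1]
  have hFE' : ∀ᵐ r ∂π, ∀ᵐ t, t ∈ Set.Icc (0:ℝ) T → E₁ t r = F t r := by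
    refine (Measure.ae_ae_comm (μ := volume) (ν := π)
      (p := fun t r => t ∈ Set.Icc (0:ℝ) T → E₁ t r = F t r) ?_).1 (.of_forall fun t => ?_)
    · exact .imp (measurable_fst measurableSet_Icc) (measurableSet_eq_fun hE₁meas hFm)
    · by_cases ht : t ∈ Set.Icc (0:ℝ) T
      · exact (hFE t ht).mono fun _ h _ => h
      · exact .of_forall fun _ h => absurd h ht
  set g : ℝ → ℝ → ℝ := fun s r => M₂ * (w * F s r ^ 2 + (1 - w) * ∫ y, F s y ^ 2 ∂π) with hg
  have hFint : Measurable fun s => ∫ y, F s y ^ 2 ∂π :=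
    (StronglyMeasurable.integral_prod_right (f := fun s y => F s y ^ 2)
      (hFm.pow_const 2).stronglyMeasurable).measurable
  have hgm : Measurable fun p : ℝ × ℝ => g p.1 p.2 := by
    have := hFint.comp (measurable_fst : Measurable (Prod.fst : ℝ × ℝ → ℝ))
    exact (((hFm.pow_const 2).const_mul w).add (this.const_mul (1 - w))).const_mul M₂
  have hgB : ∀ s r, |g s r| ≤ M₂ * (w * B ^ 2 + (1 - w) * B ^ 2) := fun s r => by
    have hint : |∫ y, F s y ^ 2 ∂π| ≤ B ^ 2 := by
      simpa using norm_integral_le_of_norm_le_const (μ := π) (f := fun y => F s y ^ 2)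
        (.of_forall (hFsq s))
    have hw' : 0 ≤ 1 - w := by linarith
    rw [hg, abs_mul, abs_of_nonneg hM₂]
    refine mul_le_mul_of_nonneg_left ((abs_add_le _ _).trans (add_le_add ?_ ?_)) hM₂
    · rw [abs_mul, abs_of_nonneg hw₀]
      exact mul_le_mul_of_nonneg_left (hFsq s r) hw₀
    · rw [abs_mul, abs_of_nonneg hw']
      exact mul_le_mul_of_nonneg_left hint hw'
  have hop : ∀ E : ℝ → ℝ → ℝ, ∀ᵐ r ∂π, ∀ t ∈ Set.Icc (0:ℝ) T, lyap2Op π w M₁ M₂ E₁ E t r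
      = duhamel (1 - w * M₁) (fun s r => (1 - w) * M₁ * (∫ y, E s y ∂π) + g s r) t r := by
    intro E
    filter_upwards [hFE'] with r hr t ht
    unfold lyap2Op duhamel
    refine intervalIntegral.integral_congr_ae ?_
    filter_upwards [hr] with s hs hst
    rw [Set.uIoc_of_le ht.1] at hst
    have hsT : s ∈ Set.Icc (0:ℝ) T := ⟨hst.1.le, hst.2.trans ht.2⟩
    have hint : ∫ y, E₁ s y ^ 2 ∂π = ∫ y, F s y ^ 2 ∂π :=
      integral_congr_ae ((hFE s hsT).mono fun y hy => by simp only [hy])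
    rw [hres, hs hsT, hint]
  obtain ⟨m, hm⟩ := exists_mean_eq_integral_duhamel hpos ha hc hca hgm hgB
  set G := M₂ * (w * B ^ 2 + (1 - w) * B ^ 2)
  set h : ℝ → ℝ → ℝ := fun s r => (1 - w) * M₁ * m s + g s r with hh
  have hhm : Measurable fun p : ℝ × ℝ => h p.1 p.2 :=
    ((m.continuous.measurable.comp measurable_fst).const_mul _).add hgm
  have hhB : ∀ s r, |h s r| ≤ (1 - w) * M₁ * ‖m‖ + G := fun s r =>
    (abs_add_le _ _).trans (add_le_add
      (by rw [abs_mul, abs_of_nonneg hc]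
          exact mul_le_mul_of_nonneg_left (m.norm_coe_le_norm s) hc) (hgB s r))
  have hK₀ := (abs_nonneg _).trans (hhB 0 0)
  -- The operator only sees its argument through its mean.
  have hmean : ∀ E : ℝ → ℝ → ℝ, (∀ t ∈ Set.Icc (0:ℝ) T, ∫ y, E t y ∂π = m t) →
      ∀ᵐ r ∂π, ∀ t ∈ Set.Icc (0:ℝ) T,
        lyap2Op π w M₁ M₂ E₁ E t r = duhamel (1 - w * M₁) h t r := by
    intro E hE
    filter_upwards [hop E] with r hr t ht
    rw [hr t ht]
    refine intervalIntegral.integral_congr fun s hs => ?_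
    rw [Set.uIcc_of_le ht.1] at hs
    simp only [hh, hE s ⟨hs.1, hs.2.trans ht.2⟩]
  rw [hres]
  refine ⟨duhamel (1 - w * M₁) h, ⟨measurable_duhamel hhm hhB, ?_, ?_, ?_, ?_⟩, ?_⟩
  · intro t ht
    rw [IntegrableOn, hres]
    exact integrable_duhamel hpos ha ht.1 hK₀ hhm fun s _ => hhB s
  · exact ⟨_, fun t ht => integral_abs_duhamel_le hpos ha ht.1 hK₀ fun s _ => hhB s⟩
  · intro t ht
    exact (hmean _ fun t ht => (hm t ht.1).symm).mono fun r hr => (hr t ht).symm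
  · exact .of_forall fun r => (continuous_duhamel hhm (hhB · r)).continuousOn
  · rintro E hEm hEi ⟨C, hC⟩ hE
    have hEmean : Measurable fun s => ∫ y, E s y ∂π :=
      (StronglyMeasurable.integral_prod_right (f := E) hEm.stronglyMeasurable).measurable
    have heq := eq_of_eq_integral_duhamel hpos ha hc hca hgm hgB hEmean m.continuous.measurable
      (fun s hs => abs_integral_le_integral_abs.trans (hC s hs))
      (fun s _ => m.norm_coe_le_norm s)
      (fun t ht => integral_congr_ae (by
        filter_upwards [hE t ht, hop E] with r hr hr'
        rw [hr, hr' t ht]))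
      (fun t ht => hm t ht.1)
    intro t ht
    filter_upwards [hE t ht, hmean E heq] with r hr hr'
    rw [hr, hr' t ht]
end

section
/- Let π be a Borel probability measure on (0,∞), w ∈ [0,1], M₁ ∈ (0,1), T > 0, and let Φ : [0,T] × (0,∞) → ℝ be measurable with ‖Φ‖_{1,T} := sup_{0≤t≤T} ∫₀^∞ |Φ(t,r)| π(dr) < ∞. Define (𝕋Φ)(t,r) = e^{−(1−wM₁) r t} + (1−w) M₁ r ∫₀ᵗ e^{−(1−wM₁) r (t−s)} ( ∫₀^∞ Φ(s,y) π(dy) ) ds. Then ‖𝕋Φ‖_{1,T} ≤ 1 + (1−w) M₁ (1−wM₁)^{−1} ‖Φ‖_{1,T}. -/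
open MeasureTheory

/-- The exponential convolution of a function bounded by `C` against the decay rate `k > 0` is
bounded by `C / k`. -/
lemma abs_integral_exp_mul_le {k t C : ℝ} (hk : 0 < k) (ht : 0 ≤ t) (hC : 0 ≤ C) {f : ℝ → ℝ}
    (hf : ∀ s ∈ Set.Icc (0:ℝ) t, |f s| ≤ C) :
    |∫ s in (0:ℝ)..t, Real.exp (-(k * (t - s))) * f s| ≤ C / k := by
  have hcont : Continuous fun s : ℝ => Real.exp (-(k * (t - s))) * C := by fun_prop
  have hint : ∫ s in (0:ℝ)..t, Real.exp (-(k * (t - s))) * C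
      = Real.exp (-(k * (t - t))) * C / k - Real.exp (-(k * (t - 0))) * C / k := by
    refine intervalIntegral.integral_eq_sub_of_hasDerivAt
      (f := fun s => Real.exp (-(k * (t - s))) * C / k) (fun s _ => ?_)
      (hcont.intervalIntegrable _ _)
    have h := (((((hasDerivAt_id s).const_sub t).const_mul k).neg.exp).mul_const C).div_const k
    refine h.congr_deriv ?_
    simp only [id, Pi.neg_apply]
    field_simp
  calc |∫ s in (0:ℝ)..t, Real.exp (-(k * (t - s))) * f s|
      ≤ ∫ s in (0:ℝ)..t, Real.exp (-(k * (t - s))) * C := by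
        rw [← Real.norm_eq_abs]
        refine intervalIntegral.norm_integral_le_of_norm_le ht (ae_of_all _ fun s hs => ?_)
          (hcont.intervalIntegrable _ _)
        rw [Real.norm_eq_abs, abs_mul, Real.abs_exp]
        exact mul_le_mul_of_nonneg_left (hf s (Set.Ioc_subset_Icc_self hs)) (Real.exp_pos _).le
    _ ≤ C / k := by
        rw [hint, sub_self, mul_zero, neg_zero, Real.exp_zero, one_mul]
        exact sub_le_self _ (by positivity)

lemma abs_lyapOp_le {π : Measure ℝ} {w M₁ : ℝ} (hw : w ≤ 1) (hM₁ : 0 ≤ M₁) (ha : 0 < 1 - w * M₁)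
    {Φ : ℝ → ℝ → ℝ} {t r C : ℝ} (ht : 0 ≤ t) (hr : 0 < r) (hC : 0 ≤ C)
    (hΦ : ∀ s ∈ Set.Icc (0:ℝ) t, |∫ y in Set.Ioi (0:ℝ), Φ s y ∂π| ≤ C) :
    |lyapOp π w M₁ Φ t r| ≤ 1 + (1 - w) * M₁ * (1 - w * M₁)⁻¹ * C := by
  have hcoef : 0 ≤ (1 - w) * M₁ := mul_nonneg (sub_nonneg.2 hw) hM₁
  refine (abs_add_le _ _).trans (add_le_add ?_ ?_)
  · rw [Real.abs_exp, Real.exp_le_one_iff, neg_nonpos]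
    positivity
  · rw [abs_mul, abs_of_nonneg (mul_nonneg hcoef hr.le)]
    calc _ ≤ (1 - w) * M₁ * r * (C / ((1 - w * M₁) * r)) :=
          mul_le_mul_of_nonneg_left (abs_integral_exp_mul_le (mul_pos ha hr) ht hC hΦ)
            (mul_nonneg hcoef hr.le)
      _ = _ := by field_simp

/-- Boundedness of the Lyapunov operator `𝕋` in the norm
`‖Φ‖_{1,T} = sup_{0≤t≤T} ∫ |Φ(t,r)| π(dr)`:
`‖𝕋Φ‖_{1,T} ≤ 1 + (1-w)M₁(1-wM₁)⁻¹ ‖Φ‖_{1,T}`. -/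
theorem lyapOp_norm_bound
    (π : Measure ℝ) [IsProbabilityMeasure π] (hπ : π (Set.Iic 0) = 0)
    (w : ℝ) (hw : w ∈ Set.Icc (0:ℝ) 1)
    (M₁ : ℝ) (hM₁ : M₁ ∈ Set.Ioo (0:ℝ) 1)
    (T : ℝ) (hT : 0 < T)
    (Φ : ℝ → ℝ → ℝ) (hΦmeas : Measurable (fun p : ℝ × ℝ => Φ p.1 p.2))
    (hΦfin : (⨆ t ∈ Set.Icc (0:ℝ) T,
        ∫⁻ r in Set.Ioi (0:ℝ), ENNReal.ofReal |Φ t r| ∂π) < ⊤) :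
    (⨆ t ∈ Set.Icc (0:ℝ) T,
        ∫⁻ r in Set.Ioi (0:ℝ), ENNReal.ofReal |lyapOp π w M₁ Φ t r| ∂π)
      ≤ 1 + ENNReal.ofReal ((1 - w) * M₁ * (1 - w * M₁)⁻¹) *
          (⨆ t ∈ Set.Icc (0:ℝ) T,
            ∫⁻ r in Set.Ioi (0:ℝ), ENNReal.ofReal |Φ t r| ∂π) := by
  have ha : 0 < 1 - w * M₁ := by nlinarith [hw.1, hw.2, hM₁.1, hM₁.2]
  set N := ⨆ t ∈ Set.Icc (0:ℝ) T, ∫⁻ r in Set.Ioi (0:ℝ), ENNReal.ofReal |Φ t r| ∂π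
  have hmean : ∀ s ∈ Set.Icc (0:ℝ) T, |∫ y in Set.Ioi (0:ℝ), Φ s y ∂π| ≤ N.toReal := by
    intro s hs
    rw [← ENNReal.ofReal_le_iff_le_toReal hΦfin.ne, ← Real.enorm_eq_ofReal_abs]
    refine (enorm_integral_le_lintegral_enorm _).trans ?_
    simp only [Real.enorm_eq_ofReal_abs]
    exact le_iSup₂ (f := fun t (_ : t ∈ Set.Icc (0:ℝ) T) =>
      ∫⁻ r in Set.Ioi (0:ℝ), ENNReal.ofReal |Φ t r| ∂π) s hs
  have hcoef : 0 ≤ (1 - w) * M₁ * (1 - w * M₁)⁻¹ :=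
    mul_nonneg (mul_nonneg (sub_nonneg.2 hw.2) hM₁.1.le) (inv_nonneg.2 ha.le)
  refine iSup₂_le fun t ht => ?_
  calc ∫⁻ r in Set.Ioi (0:ℝ), ENNReal.ofReal |lyapOp π w M₁ Φ t r| ∂π
      ≤ ∫⁻ _ in Set.Ioi (0:ℝ),
          ENNReal.ofReal (1 + (1 - w) * M₁ * (1 - w * M₁)⁻¹ * N.toReal) ∂π :=
        setLIntegral_mono measurable_const fun r hr => ENNReal.ofReal_le_ofReal <|
          abs_lyapOp_le hw.2 hM₁.1.le ha ht.1 hr ENNReal.toReal_nonneg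
            fun s hs => hmean s ⟨hs.1, hs.2.trans ht.2⟩
    _ ≤ ENNReal.ofReal (1 + (1 - w) * M₁ * (1 - w * M₁)⁻¹ * N.toReal) := by
        rw [setLIntegral_const]
        exact mul_le_of_le_one_right' prob_le_one
    _ = 1 + ENNReal.ofReal ((1 - w) * M₁ * (1 - w * M₁)⁻¹) * N := by
        rw [ENNReal.ofReal_add zero_le_one (mul_nonneg hcoef ENNReal.toReal_nonneg),
          ENNReal.ofReal_one, ENNReal.ofReal_mul hcoef, ENNReal.ofReal_toReal hΦfin.ne]
end

section
/- Let π be a Borel probability measure on (0,∞), w ∈ [0,1], M₁ ∈ (0,1), T > 0 and λ > 0. For measurable Φ, Ψ : [0,T] × (0,∞) → ℝ with finite norms ‖Φ‖_{1,T,λ} := sup_{0≤t≤T} ( e^{−λ t} ∫₀^∞ |Φ(t,r)| π(dr) ), the operator (𝕋Φ)(t,r) = e^{−(1−wM₁) r t} + (1−w) M₁ r ∫₀ᵗ e^{−(1−wM₁) r (t−s)} ( ∫₀^∞ Φ(s,y) π(dy) ) ds satisfies ‖𝕋Φ − 𝕋Ψ‖_{1,T,λ} ≤ ( (1−w) M₁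 ∫₀^∞ r / ((1−wM₁) r + λ) π(dr) ) · ‖Φ − Ψ‖_{1,T,λ}. -/
open MeasureTheory

/-- The exponentially weighted norm
`‖Φ‖_{1,T,λ} = sup_{0≤t≤T} ( e^{-λt} ∫ |Φ(t,r)| π(dr) )` (valued in `ℝ≥0∞`). -/
noncomputable def wNorm (π : Measure ℝ) (T lam : ℝ) (Φ : ℝ → ℝ → ℝ) : ENNReal :=
  ⨆ t ∈ Set.Icc (0:ℝ) T,
    ENNReal.ofReal (Real.exp (-(lam * t))) *
      ∫⁻ r in Set.Ioi (0:ℝ), ENNReal.ofReal |Φ t r| ∂π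

section WeightedNorm

variable {π : Measure ℝ} {T lam : ℝ} {Φ Ψ : ℝ → ℝ → ℝ}

theorem lintegral_ofReal_abs_le_of_wNorm (hfin : wNorm π T lam Φ < ⊤) {t : ℝ}
    (ht : t ∈ Set.Icc 0 T) :
    ∫⁻ r in Set.Ioi (0 : ℝ), ENNReal.ofReal |Φ t r| ∂π
      ≤ ENNReal.ofReal (Real.exp (lam * t) * (wNorm π T lam Φ).toReal) := by
  have h : ENNReal.ofReal (Real.exp (-(lam * t))) *
      ∫⁻ r in Set.Ioi (0 : ℝ), ENNReal.ofReal |Φ t r| ∂π ≤ wNorm π T lam Φ :=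
    le_iSup₂_of_le (f := fun t (_ : t ∈ Set.Icc (0 : ℝ) T) =>
      ENNReal.ofReal (Real.exp (-(lam * t))) *
        ∫⁻ r in Set.Ioi (0 : ℝ), ENNReal.ofReal |Φ t r| ∂π) t ht le_rfl
  rw [ENNReal.ofReal_mul (Real.exp_pos _).le, ENNReal.ofReal_toReal hfin.ne]
  calc ∫⁻ r in Set.Ioi (0 : ℝ), ENNReal.ofReal |Φ t r| ∂π
      = ENNReal.ofReal (Real.exp (lam * t)) * (ENNReal.ofReal (Real.exp (-(lam * t))) *
          ∫⁻ r in Set.Ioi (0 : ℝ), ENNReal.ofReal |Φ t r| ∂π) := by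
        rw [← mul_assoc, ← ENNReal.ofReal_mul (Real.exp_pos _).le, ← Real.exp_add]
        simp
    _ ≤ _ := by gcongr

theorem integrable_of_wNorm_lt_top (hmeas : Measurable fun p : ℝ × ℝ => Φ p.1 p.2)
    (hfin : wNorm π T lam Φ < ⊤) {t : ℝ} (ht : t ∈ Set.Icc 0 T) :
    Integrable (Φ t) (π.restrict (Set.Ioi 0)) := by
  refine ⟨(hmeas.comp measurable_prodMk_left).aestronglyMeasurable, ?_⟩
  rw [hasFiniteIntegral_iff_norm]
  exact (lintegral_ofReal_abs_le_of_wNorm hfin ht).trans_lt ENNReal.ofReal_lt_top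

theorem abs_integral_le_of_wNorm (hfin : wNorm π T lam Φ < ⊤) {t : ℝ}
    (ht : t ∈ Set.Icc 0 T) :
    |∫ r in Set.Ioi (0 : ℝ), Φ t r ∂π| ≤ Real.exp (lam * t) * (wNorm π T lam Φ).toReal := by
  have h := (ofReal_norm (∫ r in Set.Ioi (0 : ℝ), Φ t r ∂π)).le.trans
    (enorm_integral_le_lintegral_enorm _)
  simp only [← ofReal_norm, Real.norm_eq_abs] at h
  exact (ENNReal.ofReal_le_ofReal_iff (by positivity)).1
    (h.trans (lintegral_ofReal_abs_le_of_wNorm hfin ht))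

theorem wNorm_sub_le (hmeas : Measurable fun p : ℝ × ℝ => Φ p.1 p.2) :
    wNorm π T lam (fun t r => Φ t r - Ψ t r) ≤ wNorm π T lam Φ + wNorm π T lam Ψ := by
  refine iSup₂_le fun t ht => ?_
  have hm : Measurable fun r => ENNReal.ofReal |Φ t r| :=
    ((hmeas.comp measurable_prodMk_left).abs).ennreal_ofReal
  calc _ ≤ ENNReal.ofReal (Real.exp (-(lam * t))) * ∫⁻ r in Set.Ioi (0 : ℝ),
        (ENNReal.ofReal |Φ t r| + ENNReal.ofReal |Ψ t r|) ∂π := by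
        gcongr with r
        rw [← ENNReal.ofReal_add (abs_nonneg _) (abs_nonneg _)]
        exact ENNReal.ofReal_le_ofReal (abs_sub _ _)
    _ = ENNReal.ofReal (Real.exp (-(lam * t))) *
          (∫⁻ r in Set.Ioi (0 : ℝ), ENNReal.ofReal |Φ t r| ∂π) +
        ENNReal.ofReal (Real.exp (-(lam * t))) *
          (∫⁻ r in Set.Ioi (0 : ℝ), ENNReal.ofReal |Ψ t r| ∂π) := by
        rw [lintegral_add_left hm, mul_add]
    _ ≤ _ := add_le_add
        (le_iSup₂_of_le (f := fun t (_ : t ∈ Set.Icc (0 : ℝ) T) =>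
          ENNReal.ofReal (Real.exp (-(lam * t))) *
            ∫⁻ r in Set.Ioi (0 : ℝ), ENNReal.ofReal |Φ t r| ∂π) t ht le_rfl)
        (le_iSup₂_of_le (f := fun t (_ : t ∈ Set.Icc (0 : ℝ) T) =>
          ENNReal.ofReal (Real.exp (-(lam * t))) *
            ∫⁻ r in Set.Ioi (0 : ℝ), ENNReal.ofReal |Ψ t r| ∂π) t ht le_rfl)

theorem intervalIntegrable_exp_mul_integral [SFinite π]
    (hmeas : Measurable fun p : ℝ × ℝ => Φ p.1 p.2)
    (hfin : wNorm π T lam Φ < ⊤) {t : ℝ} (ht : t ∈ Set.Icc 0 T) (b : ℝ) :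
    IntervalIntegrable (fun s => Real.exp (-(b * (t - s))) *
      ∫ y in Set.Ioi (0 : ℝ), Φ s y ∂π) volume 0 t := by
  refine IntervalIntegrable.continuousOn_mul ?_ (by fun_prop)
  have hg : IntervalIntegrable
      (fun s => Real.exp (lam * s) * (wNorm π T lam Φ).toReal) volume 0 t :=
    Continuous.intervalIntegrable (by fun_prop) _ _
  refine hg.mono_fun'
    (StronglyMeasurable.integral_prod_right' hmeas.stronglyMeasurable).aestronglyMeasurable ?_
  refine (ae_restrict_iff' measurableSet_uIoc).2 (.of_forall fun s hs => ?_)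
  rw [Set.uIoc_of_le ht.1] at hs
  exact abs_integral_le_of_wNorm hfin ⟨hs.1.le, hs.2.trans ht.2⟩

end WeightedNorm

theorem integral_exp_neg_mul_exp_le {b lam : ℝ} (h : 0 < b + lam) (t : ℝ) :
    ∫ s in (0 : ℝ)..t, Real.exp (-(b * (t - s))) * Real.exp (lam * s)
      ≤ Real.exp (lam * t) / (b + lam) := by
  have hd : ∀ s ∈ Set.uIcc 0 t, HasDerivAt
      (fun s => Real.exp (-(b * (t - s)) + lam * s) / (b + lam))
      (Real.exp (-(b * (t - s))) * Real.exp (lam * s)) s := fun s _ => by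
    have h1 : HasDerivAt (fun s => -(b * (t - s)) + lam * s) (b + lam) s := by
      refine (((((hasDerivAt_id' s).const_sub t).const_mul b).fun_neg).fun_add
        ((hasDerivAt_id' s).const_mul lam)).congr_deriv ?_
      ring
    refine (h1.exp.div_const (b + lam)).congr_deriv ?_
    rw [mul_div_assoc, div_self h.ne', mul_one, Real.exp_add]
  rw [intervalIntegral.integral_eq_sub_of_hasDerivAt hd
    (Continuous.intervalIntegrable (by fun_prop) _ _)]
  have : 0 ≤ Real.exp (-(b * (t - 0)) + lam * 0) / (b + lam) := by positivity
  simp only [sub_self, mul_zero, neg_zero, zero_add] at this ⊢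
  linarith

theorem abs_lyapOp_sub_lyapOp_le {π : Measure ℝ} [SFinite π] {w M₁ T lam : ℝ}
    {Φ Ψ : ℝ → ℝ → ℝ}
    (hΦmeas : Measurable fun p : ℝ × ℝ => Φ p.1 p.2)
    (hΨmeas : Measurable fun p : ℝ × ℝ => Ψ p.1 p.2)
    (hΦfin : wNorm π T lam Φ < ⊤) (hΨfin : wNorm π T lam Ψ < ⊤)
    {t r : ℝ} (ht : t ∈ Set.Icc 0 T) (hc : 0 ≤ (1 - w) * M₁ * r)
    (hpos : 0 < (1 - w * M₁) * r + lam) :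
    |lyapOp π w M₁ Φ t r - lyapOp π w M₁ Ψ t r|
      ≤ (1 - w) * M₁ * r * (Real.exp (lam * t) / ((1 - w * M₁) * r + lam) *
        (wNorm π T lam (fun t r => Φ t r - Ψ t r)).toReal) := by
  have hfin : wNorm π T lam (fun t r => Φ t r - Ψ t r) < ⊤ :=
    (wNorm_sub_le hΦmeas).trans_lt (ENNReal.add_lt_top.2 ⟨hΦfin, hΨfin⟩)
  rw [lyapOp, lyapOp, add_sub_add_left_eq_sub, ← mul_sub,
    ← intervalIntegral.integral_sub (intervalIntegrable_exp_mul_integral hΦmeas hΦfin ht _)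
      (intervalIntegrable_exp_mul_integral hΨmeas hΨfin ht _), abs_mul, abs_of_nonneg hc]
  refine mul_le_mul_of_nonneg_left ?_ hc
  refine le_trans ?_ (mul_le_mul_of_nonneg_right (integral_exp_neg_mul_exp_le hpos t)
    ENNReal.toReal_nonneg)
  rw [← intervalIntegral.integral_mul_const, ← Real.norm_eq_abs]
  have hg : IntervalIntegrable (fun s => Real.exp (-((1 - w * M₁) * r * (t - s))) *
      Real.exp (lam * s) * (wNorm π T lam (fun t r => Φ t r - Ψ t r)).toReal) volume 0 t :=
    Continuous.intervalIntegrable (by fun_prop) _ _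
  refine intervalIntegral.norm_integral_le_of_norm_le ht.1 (.of_forall fun s hs => ?_) hg
  have hs' : s ∈ Set.Icc 0 T := ⟨hs.1.le, hs.2.trans ht.2⟩
  rw [← mul_sub, ← integral_sub (integrable_of_wNorm_lt_top hΦmeas hΦfin hs')
    (integrable_of_wNorm_lt_top hΨmeas hΨfin hs'), norm_mul, Real.norm_eq_abs,
    Real.norm_eq_abs, Real.abs_exp, mul_assoc (Real.exp _)]
  exact mul_le_mul_of_nonneg_left
    (abs_integral_le_of_wNorm (Φ := fun t r => Φ t r - Ψ t r) hfin hs') (Real.exp_pos _).le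

theorem integrableOn_div_mul_add {π : Measure ℝ} [IsFiniteMeasure π] {a lam : ℝ}
    (ha : 0 < a) (hlam : 0 < lam) :
    IntegrableOn (fun r => r / (a * r + lam)) (Set.Ioi 0) π := by
  refine Integrable.mono' (integrable_const (1 / a))
    (Measurable.aestronglyMeasurable (by fun_prop)) ?_
  refine (ae_restrict_iff' measurableSet_Ioi).2 (.of_forall fun r (hr : 0 < r) => ?_)
  rw [Real.norm_eq_abs, abs_of_nonneg (by positivity), div_le_div_iff₀ (by positivity) ha]
  linarith

/-- Contraction-type estimate for the Lyapunov operator `𝕋` in the exponentially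
weighted norm: `‖𝕋Φ − 𝕋Ψ‖_{1,T,λ} ≤ ((1-w)M₁ ∫ r/((1-wM₁)r+λ) π(dr)) ‖Φ − Ψ‖_{1,T,λ}`. -/
theorem lyapOp_weighted_contraction
    (π : Measure ℝ) [IsProbabilityMeasure π] (hπ : π (Set.Iic 0) = 0)
    (w : ℝ) (hw : w ∈ Set.Icc (0:ℝ) 1)
    (M₁ : ℝ) (hM₁ : M₁ ∈ Set.Ioo (0:ℝ) 1)
    (T : ℝ) (hT : 0 < T) (lam : ℝ) (hlam : 0 < lam)
    (Φ Ψ : ℝ → ℝ → ℝ)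
    (hΦmeas : Measurable (fun p : ℝ × ℝ => Φ p.1 p.2))
    (hΨmeas : Measurable (fun p : ℝ × ℝ => Ψ p.1 p.2))
    (hΦfin : wNorm π T lam Φ < ⊤) (hΨfin : wNorm π T lam Ψ < ⊤) :
    wNorm π T lam (fun t r => lyapOp π w M₁ Φ t r - lyapOp π w M₁ Ψ t r)
      ≤ ENNReal.ofReal
          ((1 - w) * M₁ * ∫ r in Set.Ioi (0:ℝ), r / ((1 - w * M₁) * r + lam) ∂π) *
        wNorm π T lam (fun t r => Φ t r - Ψ t r) := by
  obtain ⟨hw0, hw1⟩ := hw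
  obtain ⟨hM0, hM1⟩ := hM₁
  have ha : 0 < 1 - w * M₁ := by nlinarith
  have hc : 0 ≤ (1 - w) * M₁ := mul_nonneg (by linarith) hM0.le
  have hfin : wNorm π T lam (fun t r => Φ t r - Ψ t r) < ⊤ :=
    (wNorm_sub_le hΦmeas).trans_lt (ENNReal.add_lt_top.2 ⟨hΦfin, hΨfin⟩)
  rw [← ENNReal.ofReal_toReal hfin.ne]
  refine iSup₂_le fun t ht => ?_
  set K := (wNorm π T lam (fun t r => Φ t r - Ψ t r)).toReal with hK
  have hK0 : 0 ≤ K := ENNReal.toReal_nonneg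
  have hint : IntegrableOn (fun r => r / ((1 - w * M₁) * r + lam)) (Set.Ioi 0) π :=
    integrableOn_div_mul_add ha hlam
  have hbound : ∫⁻ r in Set.Ioi (0 : ℝ),
        ENNReal.ofReal |lyapOp π w M₁ Φ t r - lyapOp π w M₁ Ψ t r| ∂π
      ≤ ENNReal.ofReal (∫ r in Set.Ioi (0 : ℝ),
          (1 - w) * M₁ * Real.exp (lam * t) * K * (r / ((1 - w * M₁) * r + lam)) ∂π) := by
    rw [ofReal_integral_eq_lintegral_ofReal (hint.const_mul _)]
    · refine setLIntegral_mono' measurableSet_Ioi fun r (hr : 0 < r) => ?_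
      refine ENNReal.ofReal_le_ofReal ((abs_lyapOp_sub_lyapOp_le hΦmeas hΨmeas hΦfin hΨfin ht
        (by positivity) (by positivity)).trans_eq ?_)
      rw [← hK]
      ring
    · refine (ae_restrict_iff' measurableSet_Ioi).2 (.of_forall fun r (hr : 0 < r) => ?_)
      change (0 : ℝ) ≤ _
      positivity
  refine (mul_le_mul_right hbound _).trans_eq ?_
  rw [integral_const_mul, ← ENNReal.ofReal_mul (Real.exp_pos _).le, ← ENNReal.ofReal_mul' hK0]
  congr 1
  have hexp : Real.exp (-(lam * t)) * Real.exp (lam * t) = 1 := by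
    rw [← Real.exp_add]
    simp
  linear_combination ((1 - w) * M₁ * K *
    ∫ r in Set.Ioi (0 : ℝ), r / ((1 - w * M₁) * r + lam) ∂π) * hexp
end

section
/- Let ν be a σ-finite Borel measure on (0,∞) with M₁ = ∫₀^∞ z ν(dz) ∈ (0,1), let ρ be a Borel probability measure on (0,∞), w ∈ [0,1], θ ≥ 0, T > 0, and set φ̄ = θ/(1−M₁). Then there exists a unique bounded continuous function φ : [0,T] × (0,∞) → ℝ satisfying, for all t ∈ [0,T] and all r > 0, φ(t,r) = θ·e^{−r t} + ∫₀ᵗ e^{−r(t−s)} r [ w ∫₀^∞ (1 − e^{−φ̂(s,r) z}) ν(dz) + (1−w) ∫₀^∞ ∫₀^∞ (1 − e^{−φ̂(s,u) z}) ν(dz) ρ(du) ] ds, where φ̂ = max(0, min(φ̄, φ)). -/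
open MeasureTheory

/-- Truncation `φ̂ = max(0, min(c, φ))` at level `c`. -/
noncomputable def truncate (c : ℝ) (φ : ℝ → ℝ → ℝ) : ℝ → ℝ → ℝ :=
  fun t r => max 0 (min c (φ t r))

/-- The function `x ↦ ∫ (1 - e^{-xz}) ν(dz)` over `(0,∞)`. -/
noncomputable def bernsteinFun (ν : Measure ℝ) (x : ℝ) : ℝ :=
  ∫ z in Set.Ioi (0:ℝ), (1 - Real.exp (-(x * z))) ∂ν

/-- The bracket integrated against the exponential kernel in `riccatiOp`. -/
noncomputable def riccatiBracket (ν ρ : Measure ℝ) (w : ℝ) (φ : ℝ → ℝ → ℝ) (s r : ℝ) : ℝ :=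
  w * bernsteinFun ν (φ s r) + (1 - w) * ∫ u in Set.Ioi (0:ℝ), bernsteinFun ν (φ s u) ∂ρ

theorem riccatiOp_eq (ν ρ : Measure ℝ) (w θ : ℝ) (φ : ℝ → ℝ → ℝ) (t r : ℝ) :
    riccatiOp ν ρ w θ φ t r = θ * Real.exp (-(r * t)) +
      ∫ s in (0:ℝ)..t, Real.exp (-(r * (t - s))) * r * riccatiBracket ν ρ w φ s r := rfl

theorem abs_exp_neg_sub_exp_neg_le_s11 {a b : ℝ} (ha : 0 ≤ a) (hb : 0 ≤ b) :
    |Real.exp (-a) - Real.exp (-b)| ≤ |a - b| := by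
  wlog hab : a ≤ b generalizing a b
  · rw [abs_sub_comm, abs_sub_comm a b]
    exact this hb ha (le_of_not_ge hab)
  have h1 : Real.exp (-b) ≤ Real.exp (-a) := Real.exp_le_exp.2 (by linarith)
  have h2 : Real.exp (-b) = Real.exp (-a) * Real.exp (a - b) := by
    rw [← Real.exp_add]; congr 1; ring
  have h3 := Real.add_one_le_exp (a - b)
  have h4 : Real.exp (-a) ≤ 1 := Real.exp_le_one_iff.2 (by linarith)
  rw [abs_of_nonneg (by linarith), abs_of_nonpos (by linarith)]
  nlinarith [Real.exp_pos (-a)]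

theorem integrableOn_one_sub_exp {ν : Measure ℝ}
    (hν : IntegrableOn (fun z : ℝ => z) (Set.Ioi 0) ν) {x : ℝ} (hx : 0 ≤ x) :
    IntegrableOn (fun z => 1 - Real.exp (-(x * z))) (Set.Ioi 0) ν := by
  refine Integrable.mono' (hν.const_mul x) (by fun_prop) ?_
  filter_upwards [ae_restrict_mem measurableSet_Ioi] with z hz
  have hxz : 0 ≤ x * z := mul_nonneg hx (le_of_lt hz)
  simpa [abs_of_nonneg hxz] using abs_exp_neg_sub_exp_neg_le_s11 le_rfl hxz

theorem abs_bernsteinFun_sub_le {ν : Measure ℝ}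
    (hν : IntegrableOn (fun z : ℝ => z) (Set.Ioi 0) ν) {x y : ℝ} (hx : 0 ≤ x) (hy : 0 ≤ y) :
    |bernsteinFun ν x - bernsteinFun ν y| ≤ (∫ z in Set.Ioi (0:ℝ), z ∂ν) * |x - y| := by
  rw [bernsteinFun, bernsteinFun,
    ← integral_sub (integrableOn_one_sub_exp hν hx) (integrableOn_one_sub_exp hν hy),
    ← integral_mul_const]
  refine (Real.norm_eq_abs _).ge.trans (norm_integral_le_of_norm_le (hν.mul_const _) ?_)
  filter_upwards [ae_restrict_mem measurableSet_Ioi] with z hz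
  have hz' : 0 ≤ z := le_of_lt hz
  have h := abs_exp_neg_sub_exp_neg_le_s11 (mul_nonneg hy hz') (mul_nonneg hx hz')
  rw [← sub_mul, abs_mul, abs_of_nonneg hz', abs_sub_comm, abs_sub_comm y] at h
  rw [Real.norm_eq_abs, sub_sub_sub_cancel_left, abs_sub_comm]
  linarith

@[simp]
theorem bernsteinFun_zero (ν : Measure ℝ) : bernsteinFun ν 0 = 0 := by
  simp [bernsteinFun]

theorem continuousOn_bernsteinFun {ν : Measure ℝ}
    (hν : IntegrableOn (fun z : ℝ => z) (Set.Ioi 0) ν) :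
    ContinuousOn (bernsteinFun ν) (Set.Ici 0) :=
  (LipschitzOnWith.of_dist_le_mul (K := (∫ z in Set.Ioi (0:ℝ), z ∂ν).toNNReal)
    fun _ hx _ hy => (abs_bernsteinFun_sub_le hν hx hy).trans
      (mul_le_mul_of_nonneg_right (Real.le_coe_toNNReal _) (abs_nonneg _))).continuousOn

/-- Functions to which the Riccati operator is applied: continuous on `ℝ × (0,∞)`, with values
in `[0,c]`. -/
structure RiccatiAdmissible (c : ℝ) (φ : ℝ → ℝ → ℝ) : Prop where
  continuousOn : ContinuousOn (fun p : ℝ × ℝ => φ p.1 p.2) (Set.univ ×ˢ Set.Ioi 0)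
  nonneg : ∀ s r, 0 ≤ φ s r
  le : ∀ s r, φ s r ≤ c

theorem RiccatiAdmissible.zero {c : ℝ} (hc : 0 ≤ c) : RiccatiAdmissible c fun _ _ => 0 :=
  ⟨continuousOn_const, fun _ _ => le_rfl, fun _ _ => hc⟩

namespace RiccatiAdmissible

variable {ν ρ : Measure ℝ} {w θ c : ℝ} {φ ψ : ℝ → ℝ → ℝ}

theorem continuousOn_bernsteinFun_comp (hφ : RiccatiAdmissible c φ)
    (hν : IntegrableOn (fun z : ℝ => z) (Set.Ioi 0) ν) :
    ContinuousOn (fun p : ℝ × ℝ => bernsteinFun ν (φ p.1 p.2)) (Set.univ ×ˢ Set.Ioi 0) :=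
  (continuousOn_bernsteinFun hν).comp hφ.continuousOn fun _ _ => hφ.nonneg _ _

theorem abs_bernsteinFun_le (hφ : RiccatiAdmissible c φ)
    (hν : IntegrableOn (fun z : ℝ => z) (Set.Ioi 0) ν) (s r : ℝ) :
    |bernsteinFun ν (φ s r)| ≤ (∫ z in Set.Ioi (0:ℝ), z ∂ν) * c := by
  have h := abs_bernsteinFun_sub_le hν (hφ.nonneg s r) le_rfl
  rw [bernsteinFun_zero, sub_zero, sub_zero, abs_of_nonneg (hφ.nonneg s r)] at h
  refine h.trans (mul_le_mul_of_nonneg_left (hφ.le s r) ?_)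
  exact setIntegral_nonneg measurableSet_Ioi fun z hz => le_of_lt hz

theorem aestronglyMeasurable_bernsteinFun (hφ : RiccatiAdmissible c φ)
    (hν : IntegrableOn (fun z : ℝ => z) (Set.Ioi 0) ν) (s : ℝ) :
    AEStronglyMeasurable (fun u => bernsteinFun ν (φ s u)) (ρ.restrict (Set.Ioi 0)) :=
  ((hφ.continuousOn_bernsteinFun_comp hν).comp (f := fun u : ℝ => (s, u)) (by fun_prop)
    fun _ hu => ⟨trivial, hu⟩).aestronglyMeasurable measurableSet_Ioi

theorem integrableOn_bernsteinFun [IsFiniteMeasure ρ] (hφ : RiccatiAdmissible c φ)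
    (hν : IntegrableOn (fun z : ℝ => z) (Set.Ioi 0) ν) (s : ℝ) :
    IntegrableOn (fun u => bernsteinFun ν (φ s u)) (Set.Ioi 0) ρ :=
  (integrable_const _).mono' (hφ.aestronglyMeasurable_bernsteinFun hν s)
    (.of_forall fun u => hφ.abs_bernsteinFun_le hν s u)

theorem continuous_integral_bernsteinFun [IsFiniteMeasure ρ] (hφ : RiccatiAdmissible c φ)
    (hν : IntegrableOn (fun z : ℝ => z) (Set.Ioi 0) ν) :
    Continuous fun s => ∫ u in Set.Ioi (0:ℝ), bernsteinFun ν (φ s u) ∂ρ := by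
  refine continuous_of_dominated (fun s => hφ.aestronglyMeasurable_bernsteinFun hν s)
    (fun s => .of_forall fun u => hφ.abs_bernsteinFun_le hν s u) (integrable_const _) ?_
  filter_upwards [ae_restrict_mem measurableSet_Ioi] with u hu
  exact (hφ.continuousOn_bernsteinFun_comp hν).comp_continuous (f := fun s : ℝ => (s, u))
    (by fun_prop) fun _ => ⟨trivial, hu⟩

theorem continuous_riccatiBracket [IsFiniteMeasure ρ] (hφ : RiccatiAdmissible c φ)
    (hν : IntegrableOn (fun z : ℝ => z) (Set.Ioi 0) ν) :
    Continuous fun p : ℝ × Set.Ioi (0:ℝ) => riccatiBracket ν ρ w φ p.1 p.2 := by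
  have h1 : Continuous fun p : ℝ × Set.Ioi (0:ℝ) => bernsteinFun ν (φ p.1 p.2) :=
    (hφ.continuousOn_bernsteinFun_comp hν).comp_continuous
      (f := fun p : ℝ × Set.Ioi (0:ℝ) => (p.1, (p.2 : ℝ))) (by fun_prop)
      fun p => ⟨trivial, p.2.2⟩
  have h2 := (hφ.continuous_integral_bernsteinFun (ρ := ρ) hν).comp
    (continuous_fst (X := ℝ) (Y := Set.Ioi (0:ℝ)))
  exact (h1.const_mul w).add (h2.const_mul (1 - w))

theorem continuous_kernel_mul_riccatiBracket [IsFiniteMeasure ρ] (hφ : RiccatiAdmissible c φ)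
    (hν : IntegrableOn (fun z : ℝ => z) (Set.Ioi 0) ν) :
    Continuous fun q : (ℝ × Set.Ioi (0:ℝ)) × ℝ =>
      Real.exp (-((q.1.2 : ℝ) * (q.1.1 - q.2))) * q.1.2 * riccatiBracket ν ρ w φ q.2 q.1.2 :=
  .mul (by fun_prop) ((hφ.continuous_riccatiBracket hν).comp
    (f := fun q : (ℝ × Set.Ioi (0:ℝ)) × ℝ => (q.2, q.1.2)) (by fun_prop))

theorem continuous_riccatiOp [IsFiniteMeasure ρ] (hφ : RiccatiAdmissible c φ)
    (hν : IntegrableOn (fun z : ℝ => z) (Set.Ioi 0) ν) :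
    Continuous fun p : ℝ × Set.Ioi (0:ℝ) => riccatiOp ν ρ w θ φ p.1 p.2 := by
  simp_rw [riccatiOp_eq]
  refine .add (by fun_prop) ?_
  exact intervalIntegral.continuous_parametric_intervalIntegral_of_continuous
    (hφ.continuous_kernel_mul_riccatiBracket hν) continuous_fst

theorem abs_riccatiBracket_sub_le [IsProbabilityMeasure ρ] (hφ : RiccatiAdmissible c φ)
    (hψ : RiccatiAdmissible c ψ) (hν : IntegrableOn (fun z : ℝ => z) (Set.Ioi 0) ν)
    (hw : w ∈ Set.Icc (0:ℝ) 1) {d : ℝ} {s : ℝ}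
    (hd : ∀ r ∈ Set.Ioi (0:ℝ), |φ s r - ψ s r| ≤ d) {r : ℝ} (hr : 0 < r) :
    |riccatiBracket ν ρ w φ s r - riccatiBracket ν ρ w ψ s r| ≤
      (∫ z in Set.Ioi (0:ℝ), z ∂ν) * d := by
  have hM : 0 ≤ ∫ z in Set.Ioi (0:ℝ), z ∂ν :=
    setIntegral_nonneg measurableSet_Ioi fun z hz => le_of_lt hz
  have hd0 : 0 ≤ d := (abs_nonneg _).trans (hd r hr)
  have hB : ∀ u ∈ Set.Ioi (0:ℝ), |bernsteinFun ν (φ s u) - bernsteinFun ν (ψ s u)| ≤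
      (∫ z in Set.Ioi (0:ℝ), z ∂ν) * d := fun u hu =>
    (abs_bernsteinFun_sub_le hν (hφ.nonneg s u) (hψ.nonneg s u)).trans
      (mul_le_mul_of_nonneg_left (hd u hu) hM)
  have hI : |(∫ u in Set.Ioi (0:ℝ), bernsteinFun ν (φ s u) ∂ρ) -
      ∫ u in Set.Ioi (0:ℝ), bernsteinFun ν (ψ s u) ∂ρ| ≤
      (∫ z in Set.Ioi (0:ℝ), z ∂ν) * d := by
    rw [← integral_sub (hφ.integrableOn_bernsteinFun hν s) (hψ.integrableOn_bernsteinFun hν s)]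
    rw [← Real.norm_eq_abs]
    refine (norm_setIntegral_le_of_norm_le_const (measure_lt_top _ _) hB).trans ?_
    exact mul_le_of_le_one_right (mul_nonneg hM hd0) measureReal_le_one
  have h1 := hB r hr
  rw [abs_le] at h1 hI ⊢
  obtain ⟨hw0, hw1⟩ := hw
  unfold riccatiBracket
  constructor <;> nlinarith

theorem abs_riccatiOp_sub_le [IsProbabilityMeasure ρ] (hφ : RiccatiAdmissible c φ)
    (hψ : RiccatiAdmissible c ψ) (hν : IntegrableOn (fun z : ℝ => z) (Set.Ioi 0) ν)
    (hw : w ∈ Set.Icc (0:ℝ) 1) {d : ℝ}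
    (hd : ∀ s, ∀ r ∈ Set.Ioi (0:ℝ), |φ s r - ψ s r| ≤ d) {t r : ℝ} (ht : 0 ≤ t) (hr : 0 < r) :
    |riccatiOp ν ρ w θ φ t r - riccatiOp ν ρ w θ ψ t r| ≤
      (∫ z in Set.Ioi (0:ℝ), z ∂ν) * d := by
  have hM : 0 ≤ ∫ z in Set.Ioi (0:ℝ), z ∂ν :=
    setIntegral_nonneg measurableSet_Ioi fun z hz => le_of_lt hz
  have hd0 : 0 ≤ d := (abs_nonneg _).trans (hd t r hr)
  have hint : ∀ {χ : ℝ → ℝ → ℝ}, RiccatiAdmissible c χ → IntervalIntegrable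
      (fun s => Real.exp (-(r * (t - s))) * r * riccatiBracket ν ρ w χ s r) volume 0 t :=
    fun hχ => ((hχ.continuous_kernel_mul_riccatiBracket hν).comp
      (f := fun s : ℝ => ((t, (⟨r, hr⟩ : Set.Ioi (0:ℝ))), s))
      (by fun_prop)).intervalIntegrable _ _
  have hker : ∫ s in (0:ℝ)..t, Real.exp (-(r * (t - s))) * r = 1 - Real.exp (-(r * t)) := by
    rw [intervalIntegral.integral_eq_sub_of_hasDerivAt (f := fun s => Real.exp (-(r * (t - s))))]
    · simp
    · intro s _
      have h := ((((hasDerivAt_id s).const_sub t).const_mul r).neg).exp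
      simpa using h
    · exact Continuous.intervalIntegrable (by fun_prop) _ _
  rw [riccatiOp_eq, riccatiOp_eq, add_sub_add_left_eq_sub,
    ← intervalIntegral.integral_sub (hint hφ) (hint hψ), ← Real.norm_eq_abs]
  calc _ ≤ ∫ s in (0:ℝ)..t, Real.exp (-(r * (t - s))) * r *
        ((∫ z in Set.Ioi (0:ℝ), z ∂ν) * d) := by
        refine intervalIntegral.norm_integral_le_of_norm_le ht (.of_forall fun s _ => ?_)
          (Continuous.intervalIntegrable (by fun_prop) _ _)
        have hk : 0 ≤ Real.exp (-(r * (t - s))) * r := by positivity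
        rw [← mul_sub, norm_mul, Real.norm_of_nonneg hk]
        exact mul_le_mul_of_nonneg_left (hφ.abs_riccatiBracket_sub_le hψ hν hw (hd s) hr) hk
    _ = (1 - Real.exp (-(r * t))) * ((∫ z in Set.Ioi (0:ℝ), z ∂ν) * d) := by
        rw [intervalIntegral.integral_mul_const, hker]
    _ ≤ _ := mul_le_of_le_one_left (mul_nonneg hM hd0) (by linarith [Real.exp_pos (-(r * t))])

theorem abs_riccatiOp_le [IsProbabilityMeasure ρ] (hφ : RiccatiAdmissible c φ)
    (hν : IntegrableOn (fun z : ℝ => z) (Set.Ioi 0) ν) (hw : w ∈ Set.Icc (0:ℝ) 1)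
    (hθ : 0 ≤ θ) {t r : ℝ} (ht : 0 ≤ t) (hr : 0 < r) :
    |riccatiOp ν ρ w θ φ t r| ≤ θ + (∫ z in Set.Ioi (0:ℝ), z ∂ν) * c := by
  have hc : 0 ≤ c := (hφ.nonneg 0 0).trans (hφ.le 0 0)
  have h := hφ.abs_riccatiOp_sub_le (ρ := ρ) (θ := θ) (.zero hc) hν hw (d := c)
    (fun s r _ => by simpa [abs_of_nonneg (hφ.nonneg s r)] using hφ.le s r) ht hr
  have h0 : riccatiOp ν ρ w θ (fun _ _ => 0) t r = θ * Real.exp (-(r * t)) := by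
    simp [riccatiOp_eq, riccatiBracket]
  have he : Real.exp (-(r * t)) ≤ 1 := Real.exp_le_one_iff.2 (by nlinarith)
  have h1 : |θ * Real.exp (-(r * t))| ≤ θ := by
    rw [abs_of_nonneg (by positivity)]
    exact mul_le_of_le_one_right hθ he
  rw [h0] at h
  linarith [abs_sub_abs_le_abs_sub (riccatiOp ν ρ w θ φ t r) (θ * Real.exp (-(r * t)))]

end RiccatiAdmissible

theorem riccatiOp_congr {ν ρ : Measure ℝ} {w θ t r : ℝ} {φ ψ : ℝ → ℝ → ℝ} (ht : 0 ≤ t)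
    (hr : 0 < r) (h : ∀ s ∈ Set.Icc 0 t, ∀ u ∈ Set.Ioi (0:ℝ), φ s u = ψ s u) :
    riccatiOp ν ρ w θ φ t r = riccatiOp ν ρ w θ ψ t r := by
  rw [riccatiOp_eq, riccatiOp_eq]
  congr 1
  refine intervalIntegral.integral_congr fun s hs => ?_
  rw [Set.uIcc_of_le ht] at hs
  have hI : ∫ u in Set.Ioi (0:ℝ), bernsteinFun ν (φ s u) ∂ρ =
      ∫ u in Set.Ioi (0:ℝ), bernsteinFun ν (ψ s u) ∂ρ :=
    setIntegral_congr_fun measurableSet_Ioi fun u hu => by simp only [h s hs u hu]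
  simp only [riccatiBracket, hI, h s hs r hr]

theorem abs_truncate_sub_le (c : ℝ) (φ ψ : ℝ → ℝ → ℝ) (t r : ℝ) :
    |truncate c φ t r - truncate c ψ t r| ≤ |φ t r - ψ t r| := by
  refine (abs_max_sub_max_le_max _ _ _ _).trans ?_
  rw [sub_self, abs_zero, max_eq_right (abs_nonneg _)]
  refine (abs_min_sub_min_le_max _ _ _ _).trans ?_
  rw [sub_self, abs_zero, max_eq_right (abs_nonneg _)]

/-- Extension of a function on `[0,T] × (0,∞)` to the plane: constant in time outside `[0,T]`,
and zero for nonpositive `r`. -/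
noncomputable def stripExtend {T : ℝ} (hT : 0 ≤ T) (f : Set.Icc 0 T × Set.Ioi (0:ℝ) → ℝ)
    (t r : ℝ) : ℝ :=
  open Classical in if h : 0 < r then f (Set.projIcc 0 T hT t, ⟨r, h⟩) else 0

theorem stripExtend_of_pos {T : ℝ} (hT : 0 ≤ T) (f : Set.Icc 0 T × Set.Ioi (0:ℝ) → ℝ)
    (t : ℝ) {r : ℝ} (hr : 0 < r) :
    stripExtend hT f t r = f (Set.projIcc 0 T hT t, ⟨r, hr⟩) :=
  dif_pos hr

theorem stripExtend_of_mem {T : ℝ} (hT : 0 ≤ T) (f : Set.Icc 0 T × Set.Ioi (0:ℝ) → ℝ)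
    {t r : ℝ} (ht : t ∈ Set.Icc 0 T) (hr : 0 < r) :
    stripExtend hT f t r = f (⟨t, ht⟩, ⟨r, hr⟩) := by
  rw [stripExtend_of_pos hT f t hr, Set.projIcc_of_mem hT ht]

theorem continuousOn_stripExtend {T : ℝ} (hT : 0 ≤ T)
    {f : Set.Icc 0 T × Set.Ioi (0:ℝ) → ℝ} (hf : Continuous f) :
    ContinuousOn (fun p : ℝ × ℝ => stripExtend hT f p.1 p.2) (Set.univ ×ˢ Set.Ioi 0) := by
  rw [continuousOn_iff_continuous_domRestrict]
  have h : Continuous fun p : (Set.univ ×ˢ Set.Ioi 0 : Set (ℝ × ℝ)) =>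
      f (Set.projIcc 0 T hT p.1.1, ⟨p.1.2, p.2.2⟩) :=
    hf.comp ((continuous_projIcc.comp (by fun_prop)).prodMk
      (Continuous.subtype_mk (by fun_prop) _))
  exact h.congr fun p => (stripExtend_of_pos hT f _ p.2.2).symm

theorem riccatiAdmissible_truncate_stripExtend {T c : ℝ} (hT : 0 ≤ T) (hc : 0 ≤ c)
    {f : Set.Icc 0 T × Set.Ioi (0:ℝ) → ℝ} (hf : Continuous f) :
    RiccatiAdmissible c (truncate c (stripExtend hT f)) where
  continuousOn := continuousOn_const.sup (continuousOn_const.inf (continuousOn_stripExtend hT hf))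
  nonneg _ _ := le_max_left _ _
  le _ _ := max_le hc (min_le_left _ _)

/-- The truncated Riccati operator on bounded continuous functions on `[0,T] × (0,∞)`. -/
noncomputable def truncatedRiccati {ν : Measure ℝ} (ρ : Measure ℝ) [IsProbabilityMeasure ρ]
    (hν : IntegrableOn (fun z : ℝ => z) (Set.Ioi 0) ν) {w θ T c : ℝ}
    (hw : w ∈ Set.Icc (0:ℝ) 1) (hθ : 0 ≤ θ) (hT : 0 ≤ T) (hc : 0 ≤ c)
    (f : BoundedContinuousFunction (Set.Icc 0 T × Set.Ioi (0:ℝ)) ℝ) :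
    BoundedContinuousFunction (Set.Icc 0 T × Set.Ioi (0:ℝ)) ℝ :=
  .ofNormedAddCommGroup
    (fun p => riccatiOp ν ρ w θ (truncate c (stripExtend hT f)) p.1 p.2)
    (((riccatiAdmissible_truncate_stripExtend hT hc f.continuous).continuous_riccatiOp hν).comp
      (f := fun p : Set.Icc 0 T × Set.Ioi (0:ℝ) => ((p.1 : ℝ), p.2)) (by fun_prop))
    (θ + (∫ z in Set.Ioi (0:ℝ), z ∂ν) * c)
    fun p => (riccatiAdmissible_truncate_stripExtend hT hc f.continuous).abs_riccatiOp_le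
      hν hw hθ p.1.2.1 p.2.2

theorem contractingWith_truncatedRiccati {ν : Measure ℝ} (ρ : Measure ℝ)
    [IsProbabilityMeasure ρ] (hν : IntegrableOn (fun z : ℝ => z) (Set.Ioi 0) ν) {w θ T c : ℝ}
    (hw : w ∈ Set.Icc (0:ℝ) 1) (hθ : 0 ≤ θ) (hT : 0 ≤ T) (hc : 0 ≤ c)
    (hM : ∫ z in Set.Ioi (0:ℝ), z ∂ν < 1) :
    ContractingWith (∫ z in Set.Ioi (0:ℝ), z ∂ν).toNNReal
      (truncatedRiccati ρ hν hw hθ hT hc) := by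
  have hM0 : 0 ≤ ∫ z in Set.Ioi (0:ℝ), z ∂ν :=
    setIntegral_nonneg measurableSet_Ioi fun z hz => le_of_lt hz
  refine ⟨by simpa using hM, LipschitzWith.of_dist_le_mul fun f g => ?_⟩
  rw [Real.coe_toNNReal _ hM0, BoundedContinuousFunction.dist_le (by positivity)]
  intro p
  refine (riccatiAdmissible_truncate_stripExtend hT hc f.continuous).abs_riccatiOp_sub_le
    (riccatiAdmissible_truncate_stripExtend hT hc g.continuous) hν hw (fun s r hr => ?_)
    p.1.2.1 p.2.2
  refine (abs_truncate_sub_le _ _ _ _ _).trans ?_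
  rw [stripExtend_of_pos hT _ _ hr, stripExtend_of_pos hT _ _ hr]
  exact (Real.dist_eq _ _).ge.trans (BoundedContinuousFunction.dist_coe_le_dist _)

/-- Existence and uniqueness of a bounded continuous solution of the truncated
generalized Riccati equation `φ = 𝔾(φ̂)` on `[0,T] × (0,∞)`, with truncation level
`φ̄ = θ/(1-M₁)`. -/
theorem truncated_riccati_existence_uniqueness
    (ν ρ : Measure ℝ) [SigmaFinite ν] [IsProbabilityMeasure ρ]
    (hν : ν (Set.Iic 0) = 0) (hρ : ρ (Set.Iic 0) = 0)
    (hνInt : IntegrableOn (fun z : ℝ => z) (Set.Ioi 0) ν)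
    (M₁ : ℝ) (hM₁ : M₁ = ∫ z in Set.Ioi (0:ℝ), z ∂ν)
    (hM₁pos : 0 < M₁) (hM₁lt : M₁ < 1)
    (w : ℝ) (hw : w ∈ Set.Icc (0:ℝ) 1)
    (θ : ℝ) (hθ : 0 ≤ θ) (T : ℝ) (hT : 0 < T) :
    ∃ φ : ℝ → ℝ → ℝ,
      (ContinuousOn (fun p : ℝ × ℝ => φ p.1 p.2) (Set.Icc 0 T ×ˢ Set.Ioi 0) ∧
       (∃ C : ℝ, ∀ t ∈ Set.Icc (0:ℝ) T, ∀ r ∈ Set.Ioi (0:ℝ), |φ t r| ≤ C) ∧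
       (∀ t ∈ Set.Icc (0:ℝ) T, ∀ r ∈ Set.Ioi (0:ℝ),
         φ t r = riccatiOp ν ρ w θ (truncate (θ / (1 - M₁)) φ) t r)) ∧
      (∀ ψ : ℝ → ℝ → ℝ,
        ContinuousOn (fun p : ℝ × ℝ => ψ p.1 p.2) (Set.Icc 0 T ×ˢ Set.Ioi 0) →
        (∃ C : ℝ, ∀ t ∈ Set.Icc (0:ℝ) T, ∀ r ∈ Set.Ioi (0:ℝ), |ψ t r| ≤ C) →
        (∀ t ∈ Set.Icc (0:ℝ) T, ∀ r ∈ Set.Ioi (0:ℝ),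
          ψ t r = riccatiOp ν ρ w θ (truncate (θ / (1 - M₁)) ψ) t r) →
        ∀ t ∈ Set.Icc (0:ℝ) T, ∀ r ∈ Set.Ioi (0:ℝ), ψ t r = φ t r) := by
  subst hM₁
  set c := θ / (1 - ∫ z in Set.Ioi (0:ℝ), z ∂ν) with hc_def
  have hc : 0 ≤ c := div_nonneg hθ (by linarith)
  have hG := contractingWith_truncatedRiccati ρ hνInt hw hθ hT.le hc hM₁lt
  set G := truncatedRiccati ρ hνInt hw hθ hT.le hc
  have hfix : G hG.fixedPoint = hG.fixedPoint := hG.fixedPoint_isFixedPt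
  refine ⟨stripExtend hT.le hG.fixedPoint, ⟨?_, ⟨‖hG.fixedPoint‖, fun t ht r hr => ?_⟩,
    fun t ht r hr => ?_⟩, ?_⟩
  · exact (continuousOn_stripExtend hT.le hG.fixedPoint.continuous).mono
      (Set.prod_mono_left (Set.subset_univ _))
  · rw [stripExtend_of_pos _ _ _ hr]
    exact hG.fixedPoint.norm_coe_le_norm _
  · rw [stripExtend_of_mem _ _ ht hr]
    exact (DFunLike.congr_fun hfix _).symm
  · rintro ψ hψ ⟨C, hC⟩ hψ_eq t ht r hr
    let g : BoundedContinuousFunction (Set.Icc 0 T × Set.Ioi (0:ℝ)) ℝ :=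
      .ofNormedAddCommGroup (fun p => ψ p.1 p.2)
        (hψ.comp_continuous (f := fun p : Set.Icc 0 T × Set.Ioi (0:ℝ) => ((p.1 : ℝ), (p.2 : ℝ)))
          (by fun_prop) fun p => ⟨p.1.2, p.2.2⟩)
        C fun p => hC _ p.1.2 _ p.2.2
    have hg : Function.IsFixedPt G g := by
      ext p
      refine Eq.trans ?_ (hψ_eq _ p.1.2 _ p.2.2).symm
      refine riccatiOp_congr p.1.2.1 p.2.2 fun s hs u hu => ?_
      have hs' : s ∈ Set.Icc 0 T := ⟨hs.1, hs.2.trans p.1.2.2⟩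
      have h : stripExtend hT.le g s u = ψ s u := stripExtend_of_mem hT.le g hs' hu
      simp only [truncate, h]
    rw [stripExtend_of_mem _ _ ht hr, ← hG.fixedPoint_unique hg]
    rfl
end

section
/- Let π be a Borel probability measure on (0,∞) with R := ∫₀^∞ r^{−1} π(dr) < ∞, let w ∈ [0,1] and M₁ ∈ (0,1). Suppose E : [0,∞) × (0,∞) → ℝ is measurable, for π-almost every r the map t ↦ E(t,r) is differentiable with ∂E/∂t(t,r) = r { −(1−wM₁) E(t,r) + (1−w) M₁ ∫₀^∞ E(t,y) π(dy) }, E(0,r) = 1, lim_{t→∞} E(t,r) = 0, and both (t,r) ↦ E(t,r) and (t,r) ↦ r^{−1} ∂E/∂t(t,r) are integrable with respect to the product of Lebesgue measure on (0,∞) and π. Then ∫₀^∞ ∫₀^∞ E(t,r) π(dr) dt = R / (1 − M₁). -/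
open MeasureTheory

/-- The integral identity `∫₀^∞ ∫ E(t,r) π(dr) dt = R/(1-M₁)` for solutions of the
first Lyapunov equation
`∂E/∂t(t,r) = r{ -(1-wM₁) E(t,r) + (1-w) M₁ ∫ E(t,y) π(dy) }`, `E(0,·) = 1`,
with `E(t,r) → 0` as `t → ∞`. -/
theorem lyapunov_first_integral_identity
    (π : Measure ℝ) [IsProbabilityMeasure π] (hπ : π (Set.Iic 0) = 0)
    (R : ℝ) (hRint : IntegrableOn (fun r : ℝ => r⁻¹) (Set.Ioi 0) π)
    (hR : R = ∫ r in Set.Ioi (0:ℝ), r⁻¹ ∂π)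
    (w : ℝ) (hw : w ∈ Set.Icc (0:ℝ) 1)
    (M₁ : ℝ) (hM₁ : M₁ ∈ Set.Ioo (0:ℝ) 1)
    (E : ℝ → ℝ → ℝ) (hmeas : Measurable (fun p : ℝ × ℝ => E p.1 p.2))
    (hode : ∀ᵐ r ∂π,
      (∀ t ∈ Set.Ici (0:ℝ),
        HasDerivWithinAt (fun t' => E t' r)
          (r * (-(1 - w * M₁) * E t r +
            (1 - w) * M₁ * ∫ y in Set.Ioi (0:ℝ), E t y ∂π))
          (Set.Ici 0) t) ∧
      E 0 r = 1 ∧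
      Filter.Tendsto (fun t => E t r) Filter.atTop (nhds 0))
    (hint1 : Integrable (fun p : ℝ × ℝ => E p.1 p.2)
      ((volume.restrict (Set.Ioi 0)).prod (π.restrict (Set.Ioi 0))))
    (hint2 : Integrable (fun p : ℝ × ℝ =>
        p.2⁻¹ * (p.2 * (-(1 - w * M₁) * E p.1 p.2 +
          (1 - w) * M₁ * ∫ y in Set.Ioi (0:ℝ), E p.1 y ∂π)))
      ((volume.restrict (Set.Ioi 0)).prod (π.restrict (Set.Ioi 0)))) :
    ∫ t in Set.Ioi (0:ℝ), (∫ r in Set.Ioi (0:ℝ), E t r ∂π) = R / (1 - M₁) := by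
  have hpos : ∀ᵐ r ∂π, 0 < r := by
    rw [ae_iff]
    simp only [not_lt]
    exact hπ
  have hrestrict : π.restrict (Set.Ioi 0) = π := Measure.restrict_eq_self_of_ae_mem hpos
  simp only [hrestrict] at hR hode hint1 hint2 ⊢
  have hlim : ∀ᵐ r ∂π, ∫ t in Set.Ioi (0:ℝ), r⁻¹ * (r * (-(1 - w * M₁) * E t r +
      (1 - w) * M₁ * ∫ y, E t y ∂π)) = -r⁻¹ := by
    filter_upwards [hpos, hode, hint2.prod_left_ae] with r hr ⟨hderiv, hinit, htend⟩ hint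
    have hint' := hint.const_mul r
    simp only [mul_inv_cancel_left₀ hr.ne'] at hint'
    rw [integral_const_mul, integral_Ioi_of_hasDerivAt_of_tendsto
      (hderiv 0 Set.self_mem_Ici).continuousWithinAt
      (fun t ht => (hderiv t (Set.Ioi_subset_Ici_self ht)).hasDerivAt (Ici_mem_nhds ht))
      hint' htend, hinit]
    ring
  have hleft : ∫ t in Set.Ioi (0:ℝ), ∫ r, r⁻¹ * (r * (-(1 - w * M₁) * E t r +
      (1 - w) * M₁ * ∫ y, E t y ∂π)) ∂π = -R := by
    rw [integral_integral_swap hint2, integral_congr_ae hlim, integral_neg, hR]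
  have hright : ∫ t in Set.Ioi (0:ℝ), ∫ r, r⁻¹ * (r * (-(1 - w * M₁) * E t r +
      (1 - w) * M₁ * ∫ y, E t y ∂π)) ∂π =
      ∫ t in Set.Ioi (0:ℝ), -(1 - M₁) * ∫ r, E t r ∂π := by
    refine integral_congr_ae ?_
    filter_upwards [hint1.prod_right_ae] with t ht
    have hcancel : ∀ᵐ r ∂π, r⁻¹ * (r * (-(1 - w * M₁) * E t r +
        (1 - w) * M₁ * ∫ y, E t y ∂π)) =
        -(1 - w * M₁) * E t r + (1 - w) * M₁ * ∫ y, E t y ∂π := by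
      filter_upwards [hpos] with r hr
      exact inv_mul_cancel_left₀ hr.ne' _
    rw [integral_congr_ae hcancel, integral_add (ht.const_mul _) (integrable_const _),
      integral_const_mul, integral_const, probReal_univ, one_smul]
    ring
  rw [hright, integral_const_mul] at hleft
  rw [eq_div_iff (sub_pos.mpr hM₁.2).ne']
  linarith
end
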